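/- arXiv:1810.09094 — 2 statements merged into one kernel-verified Lean document; each statement's English description precedes it below -/
import Mathlib

section
/- Let ν ∈ 𝒱₀ and let (f1,f2) be a component of an automorphism of Q such that ν(f1) < ν(f2) and such that (f1,f2) is not critically resonant with respect to ν. Then for every polynomial R ∈ k[X,Y] ∖ k[Y] (i.e. R of positive degree in X), one has ν(f2 · R(f1,f2)) < ν(f1). -/
noncomputable section

open MvPolynomial

/-- The polynomial `q = xt - yz` in `k[x,y,z,t]` (variables `x,y,z,t` are `X 0, X 1, X 2, X 3`). -/
def qpoly (k : Type) [Field k] : MvPolynomial (Fin 4) k :=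
  X 0 * X 3 - X 1 * X 2

/-- The coordinate ring `k[Q] = k[x,y,z,t]/(xt - yz - 1)` of the affine quadric threefold. -/
abbrev QuadRing (k : Type) [Field k] : Type :=
  MvPolynomial (Fin 4) k ⧸ Ideal.span {qpoly k - 1}

/-- The canonical projection `π : k[x,y,z,t] → k[Q]`. -/
def qmk (k : Type) [Field k] : MvPolynomial (Fin 4) k →+* QuadRing k :=
  Ideal.Quotient.mk (Ideal.span {qpoly k - 1})

/-- A valuation on a commutative `k`-algebra `A`, with values in `ℝ ∪ {+∞}`:
`ν⁻¹({+∞}) = {0}`, `ν(a) = 0` for `a ∈ k*`, `ν(fg) = ν f + ν g`, and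
`ν(f + g) ≥ min (ν f) (ν g)`. -/
def IsValuation (k : Type) [Field k] (A : Type) [CommRing A] [Algebra k A]
    (ν : A → WithTop ℝ) : Prop :=
  (∀ f : A, ν f = ⊤ ↔ f = 0) ∧
  (∀ a : k, a ≠ 0 → ν (algebraMap k A a) = 0) ∧
  (∀ f g : A, ν (f * g) = ν f + ν g) ∧
  (∀ f g : A, min (ν f) (ν g) ≤ ν (f + g))

/-- The monomial valuation `ν_p^α` on `k[x,y,z,t]` at the point `p` with weights `α`:
the minimum of `⟨I, α⟩` over the exponents `I` appearing in the expansion of `R` in the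
shifted variables `x - p₀, y - p₁, z - p₂, t - p₃` (and `+∞` on the zero polynomial). -/
def mvalP (k : Type) [Field k] (p : Fin 4 → k) (α : Fin 4 → ℝ)
    (R : MvPolynomial (Fin 4) k) : WithTop ℝ :=
  (MvPolynomial.aeval (fun i => X i + C (p i)) R : MvPolynomial (Fin 4) k).support.inf
    fun I => ((∑ i, α i * (I i : ℝ) : ℝ) : WithTop ℝ)

/-- The monomial valuation `ν_0^α` on `k[x,y,z,t]` at the origin with weights `α`. -/
def mvalO (k : Type) [Field k] (α : Fin 4 → ℝ)
    (R : MvPolynomial (Fin 4) k) : WithTop ℝ :=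
  R.support.inf fun I => ((∑ i, α i * (I i : ℝ) : ℝ) : WithTop ℝ)

/-- The map `ν : k[Q] → ℝ ∪ {+∞}` given by `ν(f) = sup {ν_p^α(R) : π R = f}`. -/
def nuSup (k : Type) [Field k] (p : Fin 4 → k) (α : Fin 4 → ℝ)
    (f : QuadRing k) : WithTop ℝ :=
  sSup {v : WithTop ℝ | ∃ R : MvPolynomial (Fin 4) k, qmk k R = f ∧ mvalP k p α R = v}

/-- The set `𝒱₀` of valuations on `k[Q]` obtained from monomial valuations at points
`p ∈ k⁴` with weights `α ∈ (ℝ^{<0})⁴` satisfying `α₀ + α₃ = α₁ + α₂`. -/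
def V0 (k : Type) [Field k] : Set (QuadRing k → WithTop ℝ) :=
  {ν | ∃ (p : Fin 4 → k) (α : Fin 4 → ℝ),
      (∀ i, α i < 0) ∧ α 0 + α 3 = α 1 + α 2 ∧ ν = nuSup k p α}

/-- The Jacobian determinant `Jac(R₁,R₂,R₃,R₄)` of four polynomials in `k[x,y,z,t]`. -/
def jac (k : Type) [Field k] (R : Fin 4 → MvPolynomial (Fin 4) k) :
    MvPolynomial (Fin 4) k :=
  (Matrix.of fun i j : Fin 4 => MvPolynomial.pderiv j (R i)).det

/-- The monomial valuation on `k[X,Y]` with weights `w = (w₁, w₂)`. -/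
def mval2 (k : Type) [Field k] (w : Fin 2 → ℝ)
    (R : MvPolynomial (Fin 2) k) : WithTop ℝ :=
  R.support.inf fun I => ((∑ i, w i * (I i : ℝ) : ℝ) : WithTop ℝ)

open Classical in
/-- The `(w₁,w₂)`-leading part of `R ∈ k[X,Y]`: the sum of the terms of `R` whose
weighted degree realizes the monomial valuation of `R` with weights `w`. -/
def leadPart2 (k : Type) [Field k] (w : Fin 2 → ℝ) (R : MvPolynomial (Fin 2) k) :
    MvPolynomial (Fin 2) k :=
  ∑ I ∈ R.support.filter
      (fun I => ((∑ i, w i * (I i : ℝ) : ℝ) : WithTop ℝ) = mval2 k w R),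
    monomial I (R.coeff I)

open Classical in
/-- The `α`-leading part `R^w` of `R ∈ k[x,y,z,t]` (with respect to the monomial
valuation at the origin with weights `α`). -/
def leadPart4 (k : Type) [Field k] (α : Fin 4 → ℝ) (R : MvPolynomial (Fin 4) k) :
    MvPolynomial (Fin 4) k :=
  ∑ I ∈ R.support.filter
      (fun I => ((∑ i, α i * (I i : ℝ) : ℝ) : WithTop ℝ) = mvalO k α R),
    monomial I (R.coeff I)

/-- `(f₁, f₂)` is a component of an automorphism of `Q`: there is a `k`-algebra
automorphism `σ` of `k[Q]` with `σ x = f₁` and `σ y = f₂`. -/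
def IsComponent (k : Type) [Field k] (f1 f2 : QuadRing k) : Prop :=
  ∃ σ : QuadRing k ≃ₐ[k] QuadRing k, σ (qmk k (X 0)) = f1 ∧ σ (qmk k (X 1)) = f2

/-- `(f₁, f₂)` is critically resonant with respect to `ν`. -/
def CriticallyResonant (k : Type) [Field k] (ν : QuadRing k → WithTop ℝ)
    (f1 f2 : QuadRing k) : Prop :=
  (∃ (m : ℕ) (lam : k), 1 ≤ m ∧ lam ≠ 0 ∧
      ν f1 < ν (f1 - algebraMap k (QuadRing k) lam * f2 ^ m) ∧ ν f1 = m • ν f2) ∨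
  (∃ (m : ℕ) (lam : k), 1 ≤ m ∧ lam ≠ 0 ∧
      ν f2 < ν (f2 - algebraMap k (QuadRing k) lam * f1 ^ m) ∧ ν f2 = m • ν f1)

namespace MvPolynomial

variable {k σ : Type*} [Field k]

/-- The space of polynomials all of whose monomials have `w`-weight at least `c`. -/
def weightGE (w : σ → ℝ) (c : ℝ) : Submodule k (MvPolynomial σ k) :=
  restrictSupport k {I | c ≤ Finsupp.weight w I}

variable {w : σ → ℝ} {c c' : ℝ} {R S : MvPolynomial σ k}

lemma mem_weightGE : R ∈ weightGE w c ↔ ∀ I, coeff I R ≠ 0 → c ≤ Finsupp.weight w I := by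
  simp only [weightGE, mem_restrictSupport_iff, Set.subset_def, Finset.mem_coe, mem_support_iff,
    Set.mem_ofPred_eq]

lemma weightGE_anti (h : c' ≤ c) (hR : R ∈ weightGE w c) : R ∈ weightGE w c' :=
  mem_weightGE.2 fun I hI => h.trans (mem_weightGE.1 hR I hI)

lemma mul_mem_weightGE (hR : R ∈ weightGE w c) (hS : S ∈ weightGE w c') :
    R * S ∈ weightGE w (c + c') := by
  classical
  refine mem_weightGE.2 fun I hI => ?_
  obtain ⟨a, ha, b, hb, rfl⟩ := Finset.mem_add.1 (support_mul R S (mem_support_iff.2 hI))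
  rw [map_add]
  exact add_le_add (mem_weightGE.1 hR a (mem_support_iff.1 ha))
    (mem_weightGE.1 hS b (mem_support_iff.1 hb))

lemma monomial_mem_weightGE (I : σ →₀ ℕ) (a : k) :
    monomial I a ∈ weightGE w (Finsupp.weight w I) := by
  classical
  refine mem_weightGE.2 fun J hJ => ?_
  rw [coeff_monomial] at hJ
  split_ifs at hJ with h
  · rw [h]
  · exact absurd rfl hJ

lemma C_mem_weightGE (a : k) : (C a : MvPolynomial σ k) ∈ weightGE w 0 := by
  simpa using monomial_mem_weightGE (w := w) 0 a

lemma X_mem_weightGE (i : σ) : (X i : MvPolynomial σ k) ∈ weightGE w (w i) := by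
  have := monomial_mem_weightGE (w := w) (Finsupp.single i 1) (1 : k)
  rwa [Finsupp.weight_single, one_smul] at this

lemma pow_mem_weightGE (hR : R ∈ weightGE w c) (n : ℕ) : R ^ n ∈ weightGE w (n * c) := by
  induction n with
  | zero => simpa using C_mem_weightGE (1 : k)
  | succ n ih =>
    have e : ((n + 1 : ℕ) : ℝ) * c = n * c + c := by push_cast; ring
    rw [pow_succ, e]
    exact mul_mem_weightGE ih hR

lemma prod_mem_weightGE {ι : Type*} (s : Finset ι) (f : ι → MvPolynomial σ k) (c : ι → ℝ)
    (h : ∀ i ∈ s, f i ∈ weightGE w (c i)) : ∏ i ∈ s, f i ∈ weightGE w (∑ i ∈ s, c i) := by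
  classical
  induction s using Finset.induction_on with
  | empty => simpa using C_mem_weightGE (1 : k)
  | insert a s ha ih =>
    rw [Finset.prod_insert ha, Finset.sum_insert ha]
    exact mul_mem_weightGE (h a (Finset.mem_insert_self a s))
      (ih fun i hi => h i (Finset.mem_insert_of_mem hi))

lemma pderiv_mem_weightGE (i : σ) (hR : R ∈ weightGE w c) :
    pderiv i R ∈ weightGE w (c - w i) := by
  refine mem_weightGE.2 fun I hI => ?_
  rw [coeff_pderiv] at hI
  have := mem_weightGE.1 hR _ (left_ne_zero_of_mul hI)
  rw [map_add, Finsupp.weight_single, one_smul] at this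
  linarith

lemma iterate_pderiv_mem_weightGE (i : σ) (hR : R ∈ weightGE w c) (n : ℕ) :
    (pderiv i)^[n] R ∈ weightGE w (c - n * w i) := by
  induction n with
  | zero => simpa using hR
  | succ n ih =>
    rw [Function.iterate_succ_apply']
    have e : c - ((n + 1 : ℕ) : ℝ) * w i = c - n * w i - w i := by push_cast; ring
    rw [e]
    exact pderiv_mem_weightGE i ih

lemma exists_gt_mem_weightGE (h : ∀ I, coeff I R ≠ 0 → c < Finsupp.weight w I) :
    ∃ c' > c, R ∈ weightGE w c' := by
  rcases R.support.eq_empty_or_nonempty with h0 | hne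
  · refine ⟨c + 1, by linarith, mem_weightGE.2 fun I hI => ?_⟩
    have := mem_support_iff.2 hI
    simp [h0] at this
  · obtain ⟨J, hJ, hmin⟩ := R.support.exists_min_image (Finsupp.weight w) hne
    exact ⟨_, h J (mem_support_iff.1 hJ),
      mem_weightGE.2 fun I hI => hmin I (mem_support_iff.2 hI)⟩

lemma mem_weightGE_of_isWeightedHomogeneous (h : IsWeightedHomogeneous w R c) :
    R ∈ weightGE w c :=
  mem_weightGE.2 fun _ hI => (h hI).ge

lemma weightedHomogeneousComponent_mem_weightGE (w : σ → ℝ) (c : ℝ) (R : MvPolynomial σ k) :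
    weightedHomogeneousComponent w c R ∈ weightGE w c :=
  mem_weightGE_of_isWeightedHomogeneous
    (weightedHomogeneousComponent_isWeightedHomogeneous c R)

lemma weightedHomogeneousComponent_eq_zero_of_lt (h : c < c') (hR : R ∈ weightGE w c') :
    weightedHomogeneousComponent w c R = 0 := by
  classical
  ext I
  rw [coeff_weightedHomogeneousComponent, coeff_zero]
  split_ifs with hI
  · by_contra h0
    have := mem_weightGE.1 hR I h0
    linarith
  · rfl

lemma exists_sub_weightedHomogeneousComponent_mem (hR : R ∈ weightGE w c) :
    ∃ c' > c, R - weightedHomogeneousComponent w c R ∈ weightGE w c' := by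
  classical
  refine exists_gt_mem_weightGE fun I hI => ?_
  rw [coeff_sub, coeff_weightedHomogeneousComponent] at hI
  split_ifs at hI with h
  · simp at hI
  · rw [sub_zero] at hI
    exact lt_of_le_of_ne (mem_weightGE.1 hR I hI) (Ne.symm h)

lemma exists_weightedHomogeneousComponent_ne_zero (w : σ → ℝ) (h : R ≠ 0) :
    ∃ c, R ∈ weightGE w c ∧ weightedHomogeneousComponent w c R ≠ 0 := by
  classical
  obtain ⟨J, hJ, hmin⟩ :=
    R.support.exists_min_image (Finsupp.weight w) (support_nonempty.2 h)
  refine ⟨Finsupp.weight w J, mem_weightGE.2 fun I hI => hmin I (mem_support_iff.2 hI),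
    fun h0 => mem_support_iff.1 hJ ?_⟩
  have := congrArg (coeff J) h0
  rwa [coeff_weightedHomogeneousComponent, if_pos rfl, coeff_zero] at this

lemma weightedHomogeneousComponent_add_mul (hR : R ∈ weightGE w c) (hS : S ∈ weightGE w c') :
    weightedHomogeneousComponent w (c + c') (R * S) =
      weightedHomogeneousComponent w c R * weightedHomogeneousComponent w c' S := by
  obtain ⟨a, ha, hRa⟩ := exists_sub_weightedHomogeneousComponent_mem hR
  obtain ⟨b, hb, hSb⟩ := exists_sub_weightedHomogeneousComponent_mem hS
  set R₀ := weightedHomogeneousComponent w c R with hR₀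
  set S₀ := weightedHomogeneousComponent w c' S with hS₀
  have hmul : R * S = R₀ * S₀ + (R₀ * (S - S₀) + (R - R₀) * S) := by ring
  have h1 : IsWeightedHomogeneous w (R₀ * S₀) (c + c') :=
    (weightedHomogeneousComponent_isWeightedHomogeneous c R).mul
      (weightedHomogeneousComponent_isWeightedHomogeneous c' S)
  have h2 := mul_mem_weightGE (weightedHomogeneousComponent_mem_weightGE w c R) hSb
  have h3 := mul_mem_weightGE hRa hS
  rw [hmul, map_add, map_add, h1.weightedHomogeneousComponent_same,
    weightedHomogeneousComponent_eq_zero_of_lt (by linarith) h2,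
    weightedHomogeneousComponent_eq_zero_of_lt (by linarith) h3, add_zero, add_zero]

/-- Over negative weights, only finitely many exponents have weight above a given bound. -/
lemma finite_setOf_le_weight [Finite σ] (hw : ∀ i, w i < 0) (c : ℝ) :
    {I : σ →₀ ℕ | c ≤ Finsupp.weight w I}.Finite := by
  classical
  cases nonempty_fintype σ
  have hle : ∀ (I : σ →₀ ℕ) (i : σ), Finsupp.weight w I ≤ I i * w i := by
    intro I i
    rw [Finsupp.weight_apply, Finsupp.sum_fintype _ _ (by simp)]
    simp only [nsmul_eq_mul]
    rw [← Finset.add_sum_erase _ _ (Finset.mem_univ i)]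
    have : ∑ x ∈ Finset.univ.erase i, (I x : ℝ) * w x ≤ 0 :=
      Finset.sum_nonpos fun x _ => mul_nonpos_of_nonneg_of_nonpos (Nat.cast_nonneg _) (hw x).le
    linarith
  refine (Set.finite_Iic (Finsupp.equivFunOnFinite.symm fun i => ⌊c / w i⌋₊)).subset ?_
  intro I hI
  rw [Set.mem_Iic]
  intro i
  have h1 : c ≤ I i * w i := le_trans hI (hle I i)
  have h2 : (I i : ℝ) ≤ c / w i := by rwa [le_div_iff_of_neg (hw i)]
  simpa using Nat.le_floor h2

end MvPolynomial

namespace MvPolynomial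

section QuotientWeight

variable {k σ B : Type*} [Field k] [CommRing B] [Algebra k B]

/-- `v` is the largest `c` such that `f` lifts along `φ` to a polynomial of weight at least
`c`. -/
def IsQuotientWeight (φ : MvPolynomial σ k →ₐ[k] B) (w : σ → ℝ) (f : B) (v : ℝ) : Prop :=
  (∃ R, φ R = f ∧ R ∈ weightGE w v) ∧ ∀ R c, φ R = f → R ∈ weightGE w c → c ≤ v

variable {φ : MvPolynomial σ k →ₐ[k] B} {w : σ → ℝ} {f g : B} {u v : ℝ}

lemma exists_isQuotientWeight [Finite σ] (hw : ∀ i, w i < 0) (hφ : Function.Surjective φ)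
    (hf : f ≠ 0) : ∃ v, IsQuotientWeight φ w f v := by
  classical
  have key : ∀ R, φ R = f → ∃ I : σ →₀ ℕ, R ∈ weightGE w (Finsupp.weight w I) ∧
      ∀ c, R ∈ weightGE w c → c ≤ Finsupp.weight w I := by
    intro R hR
    have hR0 : R ≠ 0 := by rintro rfl; exact hf (by rw [← hR, map_zero])
    obtain ⟨I, hI, hmin⟩ := R.support.exists_min_image (Finsupp.weight w)
      (support_nonempty.2 hR0)
    exact ⟨I, mem_weightGE.2 fun J hJ => hmin J (mem_support_iff.2 hJ),
      fun c hc => mem_weightGE.1 hc I (mem_support_iff.1 hI)⟩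
  obtain ⟨R₀, hR₀⟩ := hφ f
  obtain ⟨I₀, hI₀, -⟩ := key R₀ hR₀
  have hfin : {I : σ →₀ ℕ | Finsupp.weight w I₀ ≤ Finsupp.weight w I ∧
      ∃ R, φ R = f ∧ R ∈ weightGE w (Finsupp.weight w I)}.Finite :=
    (finite_setOf_le_weight hw _).subset fun I hI => hI.1
  obtain ⟨J, hJ, hmax⟩ := hfin.exists_maximalFor (Finsupp.weight w) _
    ⟨I₀, le_rfl, R₀, hR₀, hI₀⟩
  refine ⟨Finsupp.weight w J, hJ.2, fun R c hR hc => ?_⟩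
  obtain ⟨I, hI, hIc⟩ := key R hR
  refine (hIc c hc).trans ?_
  rcases le_total (Finsupp.weight w I) (Finsupp.weight w J) with h | h
  · exact h
  · exact hmax ⟨hJ.1.trans h, R, hR, hI⟩ h

lemma IsQuotientWeight.unique (hu : IsQuotientWeight φ w f u) (hv : IsQuotientWeight φ w f v) :
    u = v := by
  obtain ⟨⟨R, hR, hRu⟩, hu'⟩ := hu
  obtain ⟨⟨S, hS, hSv⟩, hv'⟩ := hv
  exact le_antisymm (hv' R u hR hRu) (hu' S v hS hSv)

lemma weight_nonpos (hw : ∀ i, w i < 0) (I : σ →₀ ℕ) : Finsupp.weight w I ≤ 0 := by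
  rw [Finsupp.weight_apply]
  exact Finset.sum_nonpos fun i _ => nsmul_nonpos (hw i).le _

lemma IsQuotientWeight.nonpos (hw : ∀ i, w i < 0) (hf : f ≠ 0) (hv : IsQuotientWeight φ w f v) :
    v ≤ 0 := by
  obtain ⟨⟨R, hR, hRv⟩, -⟩ := hv
  have hR0 : R ≠ 0 := by rintro rfl; exact hf (by rw [← hR, map_zero])
  obtain ⟨I, hI⟩ := support_nonempty.2 hR0
  exact (mem_weightGE.1 hRv I (mem_support_iff.1 hI)).trans (weight_nonpos hw I)

lemma eq_C_of_mem_weightGE_zero (hw : ∀ i, w i < 0) {R : MvPolynomial σ k}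
    (hR : R ∈ weightGE w 0) : R = C (coeff 0 R) := by
  classical
  ext I
  rw [coeff_C]
  split_ifs with h
  · rw [h]
  · by_contra hI
    have h1 := mem_weightGE.1 hR I hI
    rw [Finsupp.weight_apply] at h1
    obtain ⟨i, hi⟩ := Finsupp.ne_iff.1 (Ne.symm h)
    have h2 : I.sum (fun i c => c • w i) < 0 := by
      refine Finset.sum_neg' (fun i _ => nsmul_nonpos (hw i).le _)
        ⟨i, Finsupp.mem_support_iff.2 hi, ?_⟩
      change I i • w i < 0
      rw [nsmul_eq_mul]
      exact mul_neg_of_pos_of_neg (Nat.cast_pos.2 (Nat.pos_of_ne_zero hi)) (hw i)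
    linarith

lemma isQuotientWeight_algebraMap [Nontrivial B] (hw : ∀ i, w i < 0) {a : k} (ha : a ≠ 0) :
    IsQuotientWeight φ w (algebraMap k B a) 0 := by
  refine ⟨⟨C a, φ.commutes a, C_mem_weightGE a⟩, fun R c hR hc => ?_⟩
  have hR0 : R ≠ 0 := by
    rintro rfl
    rw [map_zero] at hR
    exact ha ((map_eq_zero (algebraMap k B)).1 hR.symm)
  obtain ⟨I, hI⟩ := support_nonempty.2 hR0
  exact (mem_weightGE.1 hc I (mem_support_iff.1 hI)).trans (weight_nonpos hw I)

variable {h q₀ R H : MvPolynomial σ k} {δ c : ℝ}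

lemma mem_weightGE_of_mul_mem (hh : h ∈ weightGE w δ)
    (h0 : weightedHomogeneousComponent w δ h ≠ 0) (hH : h * H ∈ weightGE w c) :
    H ∈ weightGE w (c - δ) := by
  by_cases hz : H = 0
  · rw [hz]; exact zero_mem _
  obtain ⟨e, he, hne⟩ := exists_weightedHomogeneousComponent_ne_zero w hz
  refine weightGE_anti ?_ he
  by_contra! hlt
  have := weightedHomogeneousComponent_add_mul hh he
  rw [weightedHomogeneousComponent_eq_zero_of_lt (by linarith) hH] at this
  exact mul_ne_zero h0 hne this.symm

lemma IsQuotientWeight.not_dvd (hφ : ∀ R, φ R = 0 ↔ h ∣ R) (hh : h ∈ weightGE w δ)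
    (hq : Prime (weightedHomogeneousComponent w δ h)) (hv : IsQuotientWeight φ w f v)
    (hR : φ R = f) (hRv : R ∈ weightGE w v) :
    ¬ weightedHomogeneousComponent w δ h ∣ weightedHomogeneousComponent w v R := by
  rintro ⟨T, hT⟩
  have hq1 := weightedHomogeneousComponent_mem_weightGE w δ h
  have hq2 := (weightedHomogeneousComponent_isWeightedHomogeneous (w := w) δ
    h).weightedHomogeneousComponent_same
  set q := weightedHomogeneousComponent w δ h with hqdef
  have hTm : T ∈ weightGE w (v - δ) := by
    refine mem_weightGE_of_mul_mem hq1 (by rw [hq2]; exact hq.ne_zero) ?_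
    rw [← hT]
    exact weightedHomogeneousComponent_mem_weightGE w v R
  have hhT : h * T ∈ weightGE w v := by simpa using mul_mem_weightGE hh hTm
  have hcomp : ∀ h' ∈ weightGE w δ, weightedHomogeneousComponent w v (h' * T) =
      weightedHomogeneousComponent w δ h' * weightedHomogeneousComponent w (v - δ) T := by
    intro h' hh'
    have := weightedHomogeneousComponent_add_mul hh' hTm
    rwa [add_sub_cancel] at this
  have hzero : weightedHomogeneousComponent w v (R - h * T) = 0 := by
    rw [map_sub, hcomp h hh, ← hqdef]
    have h2 := hcomp q hq1
    rw [hq2, ← hT, (weightedHomogeneousComponent_isWeightedHomogeneous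
      (w := w) v R).weightedHomogeneousComponent_same] at h2
    rw [h2, sub_self]
  obtain ⟨v', hv', hmem⟩ := exists_sub_weightedHomogeneousComponent_mem (sub_mem hRv hhT)
  rw [hzero, sub_zero] at hmem
  have := hv.2 (R - h * T) v' (by rw [map_sub, (hφ _).2 (dvd_mul_right h T), sub_zero, hR]) hmem
  linarith

lemma IsQuotientWeight.mul (hφ : ∀ R, φ R = 0 ↔ h ∣ R) (hh : h ∈ weightGE w δ)
    (hq : Prime (weightedHomogeneousComponent w δ h)) (hu : IsQuotientWeight φ w f u)
    (hv : IsQuotientWeight φ w g v) : IsQuotientWeight φ w (f * g) (u + v) := by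
  obtain ⟨R, hR, hRu⟩ := hu.1
  obtain ⟨S, hS, hSv⟩ := hv.1
  refine ⟨⟨R * S, by rw [map_mul, hR, hS], mul_mem_weightGE hRu hSv⟩, fun T c hT hc => ?_⟩
  by_contra! hlt
  have hd : φ (R * S - T) = 0 := by rw [map_sub, map_mul, hR, hS, hT, sub_self]
  obtain ⟨H, hH⟩ := (hφ _).1 hd
  have hmem : R * S - T ∈ weightGE w (u + v) :=
    sub_mem (mul_mem_weightGE hRu hSv) (weightGE_anti hlt.le hc)
  have hHm := mem_weightGE_of_mul_mem hh hq.ne_zero (hH ▸ hmem)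
  have h1 := weightedHomogeneousComponent_add_mul hh hHm
  rw [add_sub_cancel, ← hH, map_sub, weightedHomogeneousComponent_eq_zero_of_lt hlt hc, sub_zero,
    weightedHomogeneousComponent_add_mul hRu hSv] at h1
  rcases hq.dvd_or_dvd (Dvd.intro _ h1.symm) with h2 | h2
  · exact hu.not_dvd hφ hh hq hR hRu h2
  · exact hv.not_dvd hφ hh hq hS hSv h2

end QuotientWeight

end MvPolynomial

section Jacobian

variable {k : Type} [Field k]

lemma jac_vec (A B C D : MvPolynomial (Fin 4) k) :
    jac k ![A, B, C, D] = ∑ i : Fin 4, (-1) ^ ((3 : ℕ) + (i : ℕ)) * pderiv i D *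
      (Matrix.of fun r s : Fin 3 => pderiv (i.succAbove s) (![A, B, C] r)).det := by
  rw [jac, Matrix.det_succ_row _ 3]
  refine Finset.sum_congr rfl fun i _ => ?_
  congr 2
  ext r s
  fin_cases r <;> rfl

lemma jac_mem_weightGE {w : Fin 4 → ℝ} {R : Fin 4 → MvPolynomial (Fin 4) k} {c : Fin 4 → ℝ}
    (h : ∀ i, R i ∈ weightGE w (c i)) :
    jac k R ∈ weightGE w (∑ i, c i - ∑ i, w i) := by
  rw [jac, Matrix.det_apply]
  refine Submodule.sum_mem _ fun τ _ => ?_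
  rw [Units.smul_def]
  refine zsmul_mem ?_ _
  have e : ∑ i, c i - ∑ i, w i = ∑ i, (c (τ i) - w i) := by
    rw [Finset.sum_sub_distrib, Equiv.sum_comp τ c]
  rw [e]
  exact prod_mem_weightGE _ _ _ fun i _ => pderiv_mem_weightGE i (h (τ i))

/-- The Jacobian determinant as a derivation in its last argument. -/
def jacDeriv (A B C : MvPolynomial (Fin 4) k) :
    Derivation k (MvPolynomial (Fin 4) k) (MvPolynomial (Fin 4) k) :=
  ∑ i : Fin 4, ((-1) ^ ((3 : ℕ) + (i : ℕ)) *
    (Matrix.of fun r s : Fin 3 => pderiv (i.succAbove s) (![A, B, C] r)).det) • pderiv i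

lemma jacDeriv_apply (A B C D : MvPolynomial (Fin 4) k) :
    jacDeriv A B C D = jac k ![A, B, C, D] := by
  rw [jac_vec, jacDeriv]
  simp only [Fin.sum_univ_four, Derivation.add_apply, Derivation.smul_apply, smul_eq_mul]
  ring

lemma jac_swap (R : Fin 4 → MvPolynomial (Fin 4) k) {i j : Fin 4} (hij : i ≠ j) :
    jac k (R ∘ Equiv.swap i j) = -jac k R := by
  have := Matrix.det_permute (Equiv.swap i j)
    (Matrix.of fun i j : Fin 4 => pderiv j (R i))
  rw [Equiv.Perm.sign_swap hij] at this
  rw [jac, jac]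
  simp only [Units.val_neg, Units.val_one, Int.cast_neg, Int.cast_one, neg_one_mul] at this
  exact this

lemma jac_eq_zero {R : Fin 4 → MvPolynomial (Fin 4) k} {i j : Fin 4} (hij : i ≠ j)
    (h : R i = R j) : jac k R = 0 :=
  Matrix.det_zero_of_row_eq hij (by ext s; simp [h])

lemma jac_swap_last (A B C D : MvPolynomial (Fin 4) k) :
    jac k ![A, B, D, C] = -jac k ![A, B, C, D] := by
  rw [← jac_swap _ (show (2 : Fin 4) ≠ 3 by decide)]
  congr 1
  ext1 r
  fin_cases r <;> rfl

lemma jac_swap_mid (A B C D : MvPolynomial (Fin 4) k) :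
    jac k ![A, C, B, D] = -jac k ![A, B, C, D] := by
  rw [← jac_swap _ (show (1 : Fin 4) ≠ 2 by decide)]
  congr 1
  ext1 r
  fin_cases r <;> rfl

variable {B : Type*} [CommRing B] [Algebra k B] {φ : MvPolynomial (Fin 4) k →ₐ[k] B}
  {h : MvPolynomial (Fin 4) k}

lemma map_jacDeriv_congr (hφ : ∀ R, φ R = 0 ↔ h ∣ R) (U V : MvPolynomial (Fin 4) k)
    {G G' : MvPolynomial (Fin 4) k} (hG : φ G = φ G') :
    φ (jacDeriv h U V G) = φ (jacDeriv h U V G') := by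
  have h0 : φ (G - G') = 0 := by rw [map_sub, hG, sub_self]
  obtain ⟨H, hH⟩ := (hφ _).1 h0
  have hh : jacDeriv h U V h = 0 := by
    rw [jacDeriv_apply]
    exact jac_eq_zero (show (0 : Fin 4) ≠ 3 by decide) rfl
  rw [← sub_eq_zero, ← map_sub, ← map_sub, hH, Derivation.leibniz, hh, smul_zero, add_zero,
    smul_eq_mul, hφ]
  exact dvd_mul_right _ _

lemma map_jacDeriv_eq_zero_of_generators (hφ : ∀ R, φ R = 0 ↔ h ∣ R)
    {U V : MvPolynomial (Fin 4) k} {F : Fin 4 → MvPolynomial (Fin 4) k}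
    (hF : ∀ G, ∃ P : MvPolynomial (Fin 4) k, φ (aeval F P) = φ G)
    (h0 : ∀ l, φ (jacDeriv h U V (F l)) = 0) (G : MvPolynomial (Fin 4) k) :
    φ (jacDeriv h U V G) = 0 := by
  obtain ⟨P, hP⟩ := hF G
  rw [← map_jacDeriv_congr hφ U V hP]
  induction P using MvPolynomial.induction_on generalizing G with
  | C a => simp [algebraMap_eq]
  | add p q hp hq =>
    rw [map_add, map_add, map_add, hp _ rfl, hq _ rfl, add_zero]
  | mul_X p i hp =>
    rw [map_mul, aeval_X, Derivation.leibniz, map_add, smul_eq_mul, smul_eq_mul, map_mul, map_mul,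
      h0, hp _ rfl, mul_zero, mul_zero, add_zero]

lemma exists_map_jac_X_ne_zero [NoZeroDivisors B] (hφ : ∀ R, φ R = 0 ↔ h ∣ R)
    {F : Fin 4 → MvPolynomial (Fin 4) k}
    (hF : ∀ G, ∃ P : MvPolynomial (Fin 4) k, φ (aeval F P) = φ G)
    (hrel : φ (F 0 * F 3 - F 1 * F 2) = φ 1) (hF0 : φ (F 0) ≠ 0) (hF1 : φ (F 1) ≠ 0)
    (hh : φ (pderiv 3 h) ≠ 0) :
    ∃ i, φ (jac k ![h, F 1, X i, F 0]) ≠ 0 := by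
  by_contra! hcon
  obtain ⟨T, hTdef⟩ : ∃ T : MvPolynomial (Fin 4) k → MvPolynomial (Fin 4) k →
      MvPolynomial (Fin 4) k → B, ∀ U V W, T U V W = φ (jac k ![h, U, V, W]) :=
    ⟨_, fun _ _ _ => rfl⟩
  have hT : ∀ U V W, φ (jacDeriv h U V W) = T U V W := fun U V W => by
    rw [jacDeriv_apply, hTdef]
  have s23 : ∀ U V W, T U W V = -T U V W := fun U V W => by
    simp only [hTdef, jac_swap_last h U V W, map_neg]
  have s12 : ∀ U V W, T V U W = -T U V W := fun U V W => by
    simp only [hTdef, jac_swap_mid h U V W, map_neg]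
  have e23 : ∀ U V, T U V V = 0 := fun U V => by
    rw [hTdef]
    rw [jac_eq_zero (show (2 : Fin 4) ≠ 3 by decide) rfl, map_zero]
  have e12 : ∀ U V, T U U V = 0 := fun U V => by
    rw [hTdef]
    rw [jac_eq_zero (show (1 : Fin 4) ≠ 2 by decide) rfl, map_zero]
  have e13 : ∀ U V, T U V U = 0 := fun U V => by rw [s23, e12, neg_zero]
  have hsym : ∀ U V W, T U V W = 0 →
      T U W V = 0 ∧ T V U W = 0 ∧ T V W U = 0 ∧ T W U V = 0 ∧ T W V U = 0 := by
    intro U V W h0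
    have h1 : T U W V = 0 := by rw [s23, h0, neg_zero]
    have h2 : T V U W = 0 := by rw [s12, h0, neg_zero]
    have h3 : T V W U = 0 := by rw [s23, h2, neg_zero]
    have h4 : T W U V = 0 := by rw [s12, h1, neg_zero]
    exact ⟨h1, h2, h3, h4, by rw [s23, h4, neg_zero]⟩
  have gen : ∀ {F' : Fin 4 → MvPolynomial (Fin 4) k} (_ : ∀ G, ∃ P : MvPolynomial (Fin 4) k,
      φ (aeval F' P) = φ G) (U V), (∀ l, T U V (F' l) = 0) → ∀ G, T U V G = 0 := by
    intro F' hF' U V h0 G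
    rw [← hT]
    exact map_jacDeriv_eq_zero_of_generators hφ hF' (fun l => by rw [hT, h0]) G
  have t01 : ∀ G, T (F 0) (F 1) G = 0 := by
    refine gen (F' := X) (fun G => ⟨G, by simp⟩) _ _ fun l => ?_
    exact (hsym _ _ _ ((hTdef _ _ _).trans (hcon l))).2.2.2.1
  have lei : ∀ U V, φ (F 0) * T U V (F 3) + φ (F 3) * T U V (F 0) -
      (φ (F 1) * T U V (F 2) + φ (F 2) * T U V (F 1)) = 0 := by
    intro U V
    have h1 := map_jacDeriv_congr hφ U V hrel
    rw [Derivation.map_one_eq_zero, map_zero, map_sub, Derivation.leibniz, Derivation.leibniz,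
      map_sub, map_add, map_add] at h1
    simpa only [smul_eq_mul, map_mul, hT] using h1
  have t023 : T (F 0) (F 2) (F 3) = 0 := by
    have h1 := lei (F 0) (F 2)
    rw [e13, e23, (hsym _ _ _ (t01 (F 2))).1] at h1
    simpa [hF0] using h1
  have t132 : T (F 1) (F 3) (F 2) = 0 := by
    have h1 := lei (F 1) (F 3)
    rw [e13, e23, (hsym _ _ _ (t01 (F 3))).2.2.1] at h1
    simpa [hF1] using h1
  obtain ⟨a1, a2, a3, a4, a5⟩ := hsym _ _ _ t023
  obtain ⟨b1, b2, b3, b4, b5⟩ := hsym _ _ _ t132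
  obtain ⟨c1, c2, c3, c4, c5⟩ := hsym _ _ _ (t01 (F 2))
  obtain ⟨d1, d2, d3, d4, d5⟩ := hsym _ _ _ (t01 (F 3))
  have tF : ∀ i j l, T (F i) (F j) (F l) = 0 := by
    intro i j l
    fin_cases i <;> fin_cases j <;> fin_cases l <;>
      first | exact e12 _ _ | exact e23 _ _ | exact e13 _ _ | exact t01 _ | assumption
  have t2 : ∀ i G l, T (F i) G (F l) = 0 := fun i G l =>
    (hsym _ _ _ (gen hF (F i) (F l) (tF i l) G)).1
  have t3 : ∀ G G' l, T G G' (F l) = 0 := fun G G' l =>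
    (hsym _ _ _ (gen hF (F l) G (t2 l G) G')).2.2.1
  have t4 := gen hF (X 0) (X 1) (t3 _ _) (X 2)
  refine hh ?_
  have e : jac k ![h, X 0, X 1, X 2] = -pderiv 3 h := by
    rw [jac]
    simp [Matrix.det_succ_row_zero, Fin.sum_univ_succ, pderiv_X, Fin.succAbove, Pi.single_apply]
    ring
  simpa only [hTdef, e, map_neg, neg_eq_zero] using t4

end Jacobian

section Valuation

variable {k σ B : Type*} [Field k] [CommRing B] [Algebra k B] {ν : AddValuation B (WithTop ℝ)}

lemma AddValuation.map_smul_of_trivial (hν : ∀ a : k, a ≠ 0 → ν (algebraMap k B a) = 0)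
    {a : k} (ha : a ≠ 0) (b : B) : ν (algebraMap k B a * b) = ν b := by
  rw [ν.map_mul, hν a ha, zero_add]

lemma AddValuation.map_pow_of_eq {f : B} {u : ℝ} (hf : ν f = u) (n : ℕ) :
    ν (f ^ n) = ((n * u : ℝ) : WithTop ℝ) := by
  rw [ν.map_pow, hf, ← WithTop.coe_nsmul, nsmul_eq_mul]

lemma AddValuation.map_multiset_prod_of_eq {M : Multiset B} {u : ℝ} (h : ∀ b ∈ M, ν b = u) :
    ν M.prod = ((M.card * u : ℝ) : WithTop ℝ) := by
  induction M using Multiset.induction_on with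
  | empty => simp [ν.map_one]
  | cons b M ih =>
    rw [Multiset.prod_cons, ν.map_mul, h b (Multiset.mem_cons_self b M),
      ih fun c hc => h c (Multiset.mem_cons_of_mem hc), ← WithTop.coe_add, Multiset.card_cons]
    congr 1
    push_cast
    ring

lemma AddValuation.map_prod_pow_of_eq [Fintype σ] {f : σ → B} {w : σ → ℝ}
    (hf : ∀ i, ν (f i) = w i) (I : σ →₀ ℕ) :
    ν (∏ i, f i ^ I i) = ((Finsupp.weight w I : ℝ) : WithTop ℝ) := by
  classical
  have key : ∀ s : Finset σ, ν (∏ i ∈ s, f i ^ I i) =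
      ((∑ i ∈ s, I i • w i : ℝ) : WithTop ℝ) := by
    intro s
    induction s using Finset.induction_on with
    | empty => simp [ν.map_one]
    | insert a s ha ih =>
      rw [Finset.prod_insert ha, Finset.sum_insert ha, ν.map_mul, ih,
        AddValuation.map_pow_of_eq (hf a), nsmul_eq_mul, WithTop.coe_add]
  rw [key, Finsupp.weight_apply, Finsupp.sum_fintype _ _ (by simp)]

variable (hν : ∀ a : k, a ≠ 0 → ν (algebraMap k B a) = 0)

include hν in
lemma le_map_aeval_of_mem_weightGE [Fintype σ] {f : σ → B} {w : σ → ℝ}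
    (hf : ∀ i, ν (f i) = w i) {R : MvPolynomial σ k} {c : ℝ} (hR : R ∈ weightGE w c) :
    (c : WithTop ℝ) ≤ ν (aeval f R) := by
  rw [aeval_def, eval₂_eq']
  refine ν.map_le_sum fun I hI => ?_
  have hI' := mem_support_iff.1 hI
  rw [AddValuation.map_smul_of_trivial hν hI', AddValuation.map_prod_pow_of_eq hf]
  exact WithTop.coe_le_coe.2 (mem_weightGE.1 hR I hI')

include hν in
lemma map_aeval_iterate_pderiv_pow_mul [CharZero k] [Fintype σ] {f : σ → B} {w : σ → ℝ}
    (hf : ∀ i, ν (f i) = w i) (i : σ) {F : MvPolynomial σ k} {e : ℝ} (hF : F ∈ weightGE w e)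
    (hFlt : (e : WithTop ℝ) < ν (aeval f F))
    (hdF : ν (aeval f (pderiv i F)) = ((e - w i : ℝ) : WithTop ℝ)) (m : ℕ)
    {G : MvPolynomial σ k} {g : ℝ} (hG : G ∈ weightGE w g)
    (hGeq : ν (aeval f G) = (g : WithTop ℝ)) :
    ν (aeval f ((pderiv i)^[m] (F ^ m * G))) = ((g + m * (e - w i) : ℝ) : WithTop ℝ) := by
  induction m generalizing G g with
  | zero => simpa using hGeq
  | succ m ih =>
    have hder : pderiv i (F ^ (m + 1) * G) =
        F ^ m * (C ((m + 1 : ℕ) : k) * (pderiv i F * G) + F * pderiv i G) := by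
      rw [pderiv_mul, pderiv_pow, Nat.add_sub_cancel, map_natCast]
      ring
    rw [Function.iterate_succ_apply, hder]
    have hm : ((m + 1 : ℕ) : k) ≠ 0 := Nat.cast_ne_zero.2 m.succ_ne_zero
    have hmem : C ((m + 1 : ℕ) : k) * (pderiv i F * G) + F * pderiv i G ∈
        weightGE w (e - w i + g) := by
      refine add_mem ?_ ?_
      · rw [C_mul']
        exact Submodule.smul_mem _ _ (mul_mem_weightGE (pderiv_mem_weightGE i hF) hG)
      · have := mul_mem_weightGE hF (pderiv_mem_weightGE i hG)
        exact weightGE_anti (by linarith) this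
    have h1 : ν (aeval f (C ((m + 1 : ℕ) : k) * (pderiv i F * G))) =
        ((e - w i + g : ℝ) : WithTop ℝ) := by
      rw [map_mul, ← algebraMap_eq, AlgHom.commutes, AddValuation.map_smul_of_trivial hν hm,
        map_mul, ν.map_mul, hdF, hGeq, WithTop.coe_add]
    have h2 : ((e - w i + g : ℝ) : WithTop ℝ) < ν (aeval f (F * pderiv i G)) := by
      rw [map_mul, ν.map_mul]
      have h3 := le_map_aeval_of_mem_weightGE hν hf (pderiv_mem_weightGE i hG)
      have e1 : ((e - w i + g : ℝ) : WithTop ℝ) = (e : WithTop ℝ) + ((g - w i : ℝ)) := by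
        rw [← WithTop.coe_add]
        congr 1
        ring
      rw [e1]
      exact lt_of_lt_of_le (WithTop.add_lt_add_right (by simp) hFlt) (by gcongr)
    have hV : ν (aeval f (C ((m + 1 : ℕ) : k) * (pderiv i F * G) + F * pderiv i G)) =
        ((e - w i + g : ℝ) : WithTop ℝ) := by
      rw [map_add, ν.map_add_eq_of_lt_left (by rw [h1]; exact h2), h1]
    rw [ih hmem hV]
    congr 1
    push_cast
    ring

end Valuation

section Binary

variable {k : Type*} [Field k]

lemma weight_fin_two (w : Fin 2 → ℝ) (I : Fin 2 →₀ ℕ) :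
    Finsupp.weight w I = I 0 * w 0 + I 1 * w 1 := by
  rw [Finsupp.weight_apply, Finsupp.sum_fintype _ _ (by simp), Fin.sum_univ_two, nsmul_eq_mul,
    nsmul_eq_mul]

lemma homogenize_multiset_prod_X_sub_C (M : Multiset k) :
    Polynomial.homogenize (M.map fun a => Polynomial.X - Polynomial.C a).prod M.card =
      (M.map fun a => (X 0 - C a * X 1 : MvPolynomial (Fin 2) k)).prod := by
  induction M using Multiset.induction_on with
  | empty => simp
  | cons a M ih =>
    rw [Multiset.map_cons, Multiset.prod_cons, Multiset.card_cons, add_comm M.card,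
      Polynomial.homogenize_mul _ _ (Polynomial.natDegree_X_sub_C_le a), ih, Multiset.map_cons,
      Multiset.prod_cons]
    · congr 1
      simp
    · rw [Polynomial.natDegree_multiset_prod_X_sub_C_eq_card]

lemma exists_homogenize_eq_prod [IsAlgClosed k] {P : Polynomial k} (hP : P ≠ 0)
    {N : ℕ} (hN : P.natDegree ≤ N) :
    ∃ (c : k) (M : Multiset k), c ≠ 0 ∧ M.card ≤ N ∧
      P.homogenize N = C c * X 1 ^ (N - M.card) *
        (M.map fun a => (X 0 - C a * X 1 : MvPolynomial (Fin 2) k)).prod := by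
  have hs := IsAlgClosed.splits P
  have hcard : P.roots.card = P.natDegree := hs.natDegree_eq_card_roots.symm
  refine ⟨P.leadingCoeff, P.roots, Polynomial.leadingCoeff_ne_zero.2 hP, hcard.trans_le hN, ?_⟩
  conv_lhs => rw [hs.eq_prod_roots]
  rw [Polynomial.homogenize_C_mul, mul_assoc]
  congr 1
  rw [← homogenize_multiset_prod_X_sub_C, ← Polynomial.homogenize_one,
    ← Polynomial.homogenize_mul _ _ (by simp)
      (Polynomial.natDegree_multiset_prod_X_sub_C_eq_card _).le, one_mul,
    Nat.sub_add_cancel (hcard.trans_le hN)]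

variable {w : Fin 2 → ℝ} {s₁ s₂ : ℕ}

lemma exists_eq_add_mul_of_weight_eq (hw1 : w 1 < 0) (hs₁ : 0 < s₁)
    (hco : s₁.Coprime s₂) (hs : s₁ * w 0 = s₂ * w 1) {I J : Fin 2 →₀ ℕ}
    (hIJ : Finsupp.weight w I = Finsupp.weight w J) (hle : I 0 ≤ J 0) :
    ∃ l, J 0 = I 0 + s₁ * l ∧ I 1 = J 1 + s₂ * l := by
  rw [weight_fin_two, weight_fin_two] at hIJ
  obtain ⟨a, ha⟩ := Nat.exists_eq_add_of_le hle
  have hint : (a : ℝ) * s₂ + s₁ * J 1 = s₁ * I 1 := by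
    have h1 : (J 0 : ℝ) = I 0 + a := by rw [ha]; push_cast; ring
    rw [h1] at hIJ
    have h2 : ((a : ℝ) * s₂ + s₁ * J 1 - s₁ * I 1) * w 1 = 0 := by
      linear_combination (-s₁ : ℝ) * hIJ - a * hs
    rcases mul_eq_zero.1 h2 with h3 | h3
    · linarith
    · exact absurd h3 hw1.ne
  have hnat : a * s₂ + s₁ * J 1 = s₁ * I 1 := by exact_mod_cast hint
  have hdvd : s₁ ∣ a * s₂ :=
    (Nat.dvd_add_left (dvd_mul_right s₁ (J 1))).1 (hnat ▸ dvd_mul_right s₁ (I 1))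
  obtain ⟨l, rfl⟩ := hco.dvd_of_dvd_mul_right hdvd
  refine ⟨l, ha, Nat.eq_of_mul_eq_mul_left hs₁ ?_⟩
  rw [← hnat]
  ring

/-- A binary form that is homogeneous for commensurable negative weights splits into
quasi-linear factors. -/
lemma exists_eq_prod_of_isWeightedHomogeneous [IsAlgClosed k] (hw1 : w 1 < 0)
    (hs₁ : 0 < s₁) (hco : s₁.Coprime s₂) (hs : s₁ * w 0 = s₂ * w 1)
    {S : MvPolynomial (Fin 2) k} {W : ℝ} (hS : IsWeightedHomogeneous w S W) (hS0 : S ≠ 0) :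
    ∃ (c : k) (a b : ℕ) (M : Multiset k), c ≠ 0 ∧
      (a + s₁ * M.card) * w 0 + b * w 1 = W ∧
      S = C c * (X 0 ^ a * X 1 ^ b) * (M.map fun l => X 0 ^ s₁ - C l * X 1 ^ s₂).prod := by
  obtain ⟨I₀, hI₀, hmin⟩ := S.support.exists_min_image (fun I => I 0) (support_nonempty.2 hS0)
  obtain ⟨I₁, hI₁, hmax⟩ := S.support.exists_max_image (fun I => I 0) (support_nonempty.2 hS0)
  have hwt : ∀ I ∈ S.support, Finsupp.weight w I = W := fun I hI => hS (mem_support_iff.1 hI)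
  obtain ⟨N, hN, -⟩ := exists_eq_add_mul_of_weight_eq hw1 hs₁ hco hs
    ((hwt _ hI₀).trans (hwt _ hI₁).symm) (hmin _ hI₁)
  have hl : ∀ I ∈ S.support, ∃ l ≤ N, I 0 = I₀ 0 + s₁ * l ∧ I 1 = I₁ 1 + s₂ * (N - l) := by
    intro I hI
    obtain ⟨l, hl, -⟩ := exists_eq_add_mul_of_weight_eq hw1 hs₁ hco hs
      ((hwt _ hI₀).trans (hwt _ hI).symm) (hmin _ hI)
    obtain ⟨l', hl', hl1⟩ := exists_eq_add_mul_of_weight_eq hw1 hs₁ hco hs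
      ((hwt _ hI).trans (hwt _ hI₁).symm) (hmax _ hI)
    have : N = l + l' := by
      refine Nat.eq_of_mul_eq_mul_left hs₁ ?_
      rw [mul_add]
      omega
    exact ⟨l, by omega, hl, by rw [hl1, this, Nat.add_sub_cancel_left]⟩
  choose! l hlN hl0 hl1 using hl
  let P : Polynomial k := ∑ I ∈ S.support, Polynomial.monomial (l I) (coeff I S)
  have hPdeg : P.natDegree ≤ N := Polynomial.natDegree_sum_le_of_forall_le _ _ fun I hI =>
    (Polynomial.natDegree_monomial_le _).trans (hlN I hI)
  have hSP : S = X 0 ^ I₀ 0 * X 1 ^ I₁ 1 *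
      aeval ![X 0 ^ s₁, X 1 ^ s₂] (Polynomial.homogenize P N) := by
    conv_lhs => rw [S.as_sum]
    rw [Polynomial.homogenize_finsetSum, map_sum, Finset.mul_sum]
    refine Finset.sum_congr rfl fun I hI => ?_
    rw [Polynomial.homogenize_monomial (hlN I hI), aeval_monomial, monomial_eq,
      Finsupp.prod_fintype _ _ (by simp), Finsupp.prod_fintype _ _ (by simp), Fin.prod_univ_two,
      Fin.prod_univ_two, hl0 I hI, hl1 I hI, algebraMap_eq]
    simp
    ring
  have hP0 : P ≠ 0 := by
    intro h
    rw [h, Polynomial.homogenize_zero] at hSP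
    exact hS0 (by rw [hSP]; simp)
  obtain ⟨c, M, hc, hM, hPM⟩ := exists_homogenize_eq_prod hP0 hPdeg
  refine ⟨c, I₀ 0, I₁ 1 + s₂ * (N - M.card), M, hc, ?_, ?_⟩
  · rw [← hwt _ hI₁, weight_fin_two, hN]
    push_cast [Nat.cast_sub hM]
    linear_combination ((M.card : ℝ) - N) * hs
  · rw [hSP, hPM, map_mul, map_mul, map_multiset_prod, Multiset.map_map]
    have e : (M.map ((aeval (R := k) ![(X 0 : MvPolynomial (Fin 2) k) ^ s₁, X 1 ^ s₂]) ∘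
        fun a => X 0 - C a * X 1)) = M.map fun l => X 0 ^ s₁ - C l * X 1 ^ s₂ :=
      Multiset.map_congr rfl fun a _ => by simp [algebraMap_eq]
    rw [e]
    simp [algebraMap_eq]
    ring

end Binary

section Binary

variable {k B : Type*} [Field k] [CommRing B] [Algebra k B] {ν : AddValuation B (WithTop ℝ)}
  {f : Fin 2 → B} {w : Fin 2 → ℝ}

/-- A quasi-homogeneous binary form is a monomial, unless the weights are commensurable. -/
lemma eq_monomial_or_exists_coprime (hw : ∀ i, w i < 0) {S : MvPolynomial (Fin 2) k} {W : ℝ}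
    (hS : IsWeightedHomogeneous w S W) (hS0 : S ≠ 0) :
    (∃ I c, c ≠ 0 ∧ Finsupp.weight w I = W ∧ S = monomial I c) ∨
      ∃ s₁ s₂ : ℕ, 0 < s₁ ∧ s₁.Coprime s₂ ∧ s₁ * w 0 = s₂ * w 1 := by
  by_cases hsub : (S.support : Set (Fin 2 →₀ ℕ)).Subsingleton
  · left
    obtain ⟨I, hI⟩ := support_nonempty.2 hS0
    have hsupp : S.support = {I} := Finset.eq_singleton_iff_unique_mem.2
      ⟨hI, fun J hJ => hsub hJ hI⟩
    refine ⟨I, coeff I S, mem_support_iff.1 hI, hS (mem_support_iff.1 hI), ?_⟩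
    conv_lhs => rw [S.as_sum, hsupp, Finset.sum_singleton]
  · right
    have main : ∀ I J : Fin 2 →₀ ℕ, Finsupp.weight w I = Finsupp.weight w J → I 0 < J 0 →
        ∃ s₁ s₂ : ℕ, 0 < s₁ ∧ s₁.Coprime s₂ ∧ s₁ * w 0 = s₂ * w 1 := by
      intro I J hIJ hlt
      rw [weight_fin_two, weight_fin_two] at hIJ
      have h0 : (I 0 : ℝ) < J 0 := Nat.cast_lt.2 hlt
      have h1 : J 1 < I 1 := by
        by_contra! hle
        have : (I 1 : ℝ) ≤ J 1 := Nat.cast_le.2 hle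
        nlinarith [mul_pos_of_neg_of_neg (hw 0) (sub_neg.2 h0),
          mul_nonneg (sub_nonneg.2 this) (neg_nonneg.2 (hw 1).le)]
      have hA : 0 < J 0 - I 0 := Nat.sub_pos_of_lt hlt
      obtain ⟨g, s₁, s₂, hg, hco, e1, e2⟩ := Nat.exists_coprime' (m := J 0 - I 0) (n := I 1 - J 1)
        (Nat.gcd_pos_of_pos_left _ hA)
      refine ⟨s₁, s₂, Nat.pos_of_mul_pos_right (e1 ▸ hA), hco, ?_⟩
      have e1' : (J 0 : ℝ) - I 0 = s₁ * g := by
        rw [← Nat.cast_sub hlt.le, e1, Nat.cast_mul]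
      have e2' : (I 1 : ℝ) - J 1 = s₂ * g := by
        rw [← Nat.cast_sub h1.le, e2, Nat.cast_mul]
      have hg' : (g : ℝ) ≠ 0 := Nat.cast_ne_zero.2 hg.ne'
      refine mul_left_cancel₀ hg' ?_
      linear_combination -w 0 * e1' + w 1 * e2' - hIJ
    obtain ⟨I, hI, J, hJ, hne⟩ := Set.not_subsingleton_iff.1 hsub
    have hIJ : Finsupp.weight w I = Finsupp.weight w J :=
      (hS (mem_support_iff.1 hI)).trans (hS (mem_support_iff.1 hJ)).symm
    rcases lt_trichotomy (I 0) (J 0) with h | h | h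
    · exact main I J hIJ h
    · exfalso
      refine hne (Finsupp.ext fun i => ?_)
      have h1 : I 1 = J 1 := by
        rw [weight_fin_two, weight_fin_two, h, add_right_inj, mul_left_inj' (hw 1).ne] at hIJ
        exact_mod_cast hIJ
      fin_cases i
      · exact h
      · exact h1
    · exact main J I hIJ.symm h

variable (hν : ∀ a : k, a ≠ 0 → ν (algebraMap k B a) = 0) (hf : ∀ i, ν (f i) = w i)

include hν hf in
lemma map_aeval_monomial_eq (I : Fin 2 →₀ ℕ) {c : k} (hc : c ≠ 0) :
    ν (aeval f (monomial I c)) = ((Finsupp.weight w I : ℝ) : WithTop ℝ) := by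
  rw [aeval_monomial, AddValuation.map_smul_of_trivial hν hc, Finsupp.prod_fintype _ _ (by simp),
    AddValuation.map_prod_pow_of_eq hf]

/-- The quasi-linear form `X₀ ^ s₁ - l X₁ ^ s₂`. -/
abbrev quasiLinear (s₁ s₂ : ℕ) (l : k) : MvPolynomial (Fin 2) k :=
  X 0 ^ s₁ - C l * X 1 ^ s₂

lemma quasiLinear_mem_weightGE {s₁ s₂ : ℕ} (hs : s₁ * w 0 = s₂ * w 1) (l : k) :
    quasiLinear s₁ s₂ l ∈ weightGE w (s₁ * w 0) := by
  refine sub_mem (pow_mem_weightGE (X_mem_weightGE 0) s₁) ?_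
  rw [C_mul', hs]
  exact Submodule.smul_mem _ _ (pow_mem_weightGE (X_mem_weightGE 1) s₂)

variable {s₁ s₂ : ℕ}

lemma prod_quasiLinear_mem_weightGE (hs : s₁ * w 0 = s₂ * w 1) (c : k) (a b : ℕ)
    (N : Multiset k) :
    C c * (X 0 ^ a * X 1 ^ b) * (N.map (quasiLinear s₁ s₂)).prod ∈
      weightGE w (a * w 0 + b * w 1 + N.card * (s₁ * w 0)) := by
  refine mul_mem_weightGE ?_ ?_
  · rw [C_mul']
    exact Submodule.smul_mem _ _ (mul_mem_weightGE (pow_mem_weightGE (X_mem_weightGE 0) a)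
      (pow_mem_weightGE (X_mem_weightGE 1) b))
  · induction N using Multiset.induction_on with
    | empty => simpa using C_mem_weightGE (w := w) (1 : k)
    | cons l N ih =>
      rw [Multiset.map_cons, Multiset.prod_cons, Multiset.card_cons]
      exact weightGE_anti (by push_cast; linarith)
        (mul_mem_weightGE (quasiLinear_mem_weightGE hs l) ih)

include hν hf in
lemma map_aeval_prod_quasiLinear {c : k} (hc : c ≠ 0) (a b : ℕ) {N : Multiset k}
    (hN : ∀ l ∈ N, ν (aeval f (quasiLinear s₁ s₂ l)) = ((s₁ * w 0 : ℝ) : WithTop ℝ)) :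
    ν (aeval f (C c * (X 0 ^ a * X 1 ^ b) * (N.map (quasiLinear s₁ s₂)).prod)) =
      ((a * w 0 + b * w 1 + N.card * (s₁ * w 0) : ℝ) : WithTop ℝ) := by
  rw [map_mul, map_mul (aeval f), map_multiset_prod, ν.map_mul, ν.map_mul, ← algebraMap_eq,
    AlgHom.commutes, hν c hc, zero_add, map_mul (aeval f), ν.map_mul, map_pow (aeval f),
    map_pow (aeval f), aeval_X, aeval_X, AddValuation.map_pow_of_eq (hf 0), AddValuation.map_pow_of_eq (hf 1),
    AddValuation.map_multiset_prod_of_eq (u := s₁ * w 0), Multiset.card_map, Multiset.card_map,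
    WithTop.coe_add, WithTop.coe_add]
  intro b hb
  rw [Multiset.map_map] at hb
  obtain ⟨l, hl, rfl⟩ := Multiset.mem_map.1 hb
  exact hN l hl

include hν hf in
/-- At most one of the quasi-linear forms degenerates under the valuation. -/
lemma map_aeval_quasiLinear_eq_of_ne (hs : s₁ * w 0 = s₂ * w 1) {l l' : k} (hne : l ≠ l')
    (hl : ((s₁ * w 0 : ℝ) : WithTop ℝ) < ν (aeval f (quasiLinear s₁ s₂ l))) :
    ν (aeval f (quasiLinear s₁ s₂ l')) = ((s₁ * w 0 : ℝ) : WithTop ℝ) := by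
  have e : quasiLinear s₁ s₂ l' = quasiLinear s₁ s₂ l + C (l - l') * X 1 ^ s₂ := by
    rw [quasiLinear, quasiLinear, C_sub]
    ring
  have h1 : ν (aeval f (C (l - l') * X 1 ^ s₂ : MvPolynomial (Fin 2) k)) =
      ((s₁ * w 0 : ℝ) : WithTop ℝ) := by
    rw [map_mul, ← algebraMap_eq, AlgHom.commutes,
      AddValuation.map_smul_of_trivial hν (sub_ne_zero.2 hne), map_pow, aeval_X,
      AddValuation.map_pow_of_eq (hf 1), hs]
  rw [e, map_add, ν.map_add_eq_of_lt_right (by rw [h1]; exact hl), h1]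

include hν hf in
/-- Away from critical resonance, a suitable iterated derivative of a quasi-homogeneous form
takes its expected value. -/
lemma exists_map_aeval_iterate_pderiv_eq [IsAlgClosed k] [CharZero k] (hw : ∀ i, w i < 0)
    (hnc : ∀ (m : ℕ) (l : k), 1 ≤ m → l ≠ 0 → w 0 = m * w 1 →
      ¬ ((w 0 : ℝ) : WithTop ℝ) < ν (f 0 - algebraMap k B l * f 1 ^ m))
    {S : MvPolynomial (Fin 2) k} {W : ℝ} (hS : IsWeightedHomogeneous w S W) (hS0 : S ≠ 0) :
    ∃ m : ℕ, ν (aeval f ((pderiv 0)^[m] S)) = ((W - m * w 0 : ℝ) : WithTop ℝ) ∧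
      (m = 0 ∨ W ≤ 2 * m * w 0) := by
  classical
  rcases eq_monomial_or_exists_coprime hw hS hS0 with
    ⟨I, c, hc, hI, rfl⟩ | ⟨s₁, s₂, hs₁, hco, hs⟩
  · refine ⟨0, ?_, Or.inl rfl⟩
    rw [Function.iterate_zero_apply, map_aeval_monomial_eq hν hf I hc, hI]
    simp
  obtain ⟨c, a, b, M, hc, hW, rfl⟩ := exists_eq_prod_of_isWeightedHomogeneous (hw 1) hs₁ hco hs
    hS hS0
  by_cases hall : ∀ l ∈ M, ν (aeval f (quasiLinear s₁ s₂ l)) = ((s₁ * w 0 : ℝ) : WithTop ℝ)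
  · refine ⟨0, ?_, Or.inl rfl⟩
    rw [Function.iterate_zero_apply]
    refine (map_aeval_prod_quasiLinear hν hf hc a b hall).trans ?_
    congr 1
    push_cast
    linear_combination hW
  push Not at hall
  obtain ⟨l, hlM, hl⟩ := hall
  replace hl := lt_of_le_of_ne
    (le_map_aeval_of_mem_weightGE hν hf (quasiLinear_mem_weightGE hs l)) hl.symm
  have hl0 : l ≠ 0 := by
    rintro rfl
    simp [AddValuation.map_pow_of_eq (hf 0)] at hl
  have hs₂ : 1 ≤ s₂ := by
    rw [Nat.one_le_iff_ne_zero]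
    rintro rfl
    have h1 := mul_neg_of_pos_of_neg (Nat.cast_pos (α := ℝ).2 hs₁) (hw 0)
    simp at hs
    rcases hs with hs | hs
    · omega
    · exact (hw 0).ne hs
  have hs₁2 : 2 ≤ s₁ := by
    by_contra! hlt
    obtain rfl : s₁ = 1 := by omega
    refine hnc s₂ l hs₂ hl0 (by simpa using hs) ?_
    simpa [algebraMap_eq] using hl
  set N := M.filter (· ≠ l)
  set m := M.count l
  have hm : 1 ≤ m := Multiset.one_le_count_iff_mem.2 hlM
  have hM : M = Multiset.replicate m l + N := by
    rw [← Multiset.filter_eq', Multiset.filter_add_not]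
  have hcard : (M.card : ℝ) = m + N.card := by
    conv_lhs => rw [hM]
    simp
  have hdF : ν (aeval f (pderiv 0 (quasiLinear s₁ s₂ l))) =
      ((s₁ * w 0 - w 0 : ℝ) : WithTop ℝ) := by
    have e : pderiv 0 (quasiLinear s₁ s₂ l) = C (s₁ : k) * X 0 ^ (s₁ - 1) := by
      rw [quasiLinear, map_sub, pderiv_C_mul, pderiv_pow, pderiv_pow, pderiv_X_self,
        pderiv_X_of_ne (by decide), map_natCast]
      simp
    rw [e, map_mul, ← algebraMap_eq, AlgHom.commutes,
      AddValuation.map_smul_of_trivial hν (Nat.cast_ne_zero.2 hs₁.ne'), map_pow, aeval_X,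
      AddValuation.map_pow_of_eq (hf 0), Nat.cast_sub hs₁]
    congr 1
    push_cast
    ring
  have hN : ∀ l' ∈ N, ν (aeval f (quasiLinear s₁ s₂ l')) = ((s₁ * w 0 : ℝ) : WithTop ℝ) :=
    fun l' hl' => map_aeval_quasiLinear_eq_of_ne hν hf hs (Multiset.mem_filter.1 hl').2.symm hl
  have key := map_aeval_iterate_pderiv_pow_mul hν hf 0 (quasiLinear_mem_weightGE hs l) hl hdF m
    (prod_quasiLinear_mem_weightGE hs c a b N) (map_aeval_prod_quasiLinear hν hf hc a b hN)
  refine ⟨m, ?_, Or.inr ?_⟩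
  · have e : C c * (X 0 ^ a * X 1 ^ b) * (M.map (quasiLinear s₁ s₂)).prod =
        quasiLinear s₁ s₂ l ^ m *
          (C c * (X 0 ^ a * X 1 ^ b) * (N.map (quasiLinear s₁ s₂)).prod) := by
      conv_lhs => rw [hM]
      rw [Multiset.map_add, Multiset.prod_add, Multiset.map_replicate, Multiset.prod_replicate]
      ring
    refine (congrArg (fun S => ν (aeval f ((pderiv 0)^[m] S))) e).trans (key.trans ?_)
    congr 1
    rw [hcard] at hW
    linear_combination hW
  · rw [hcard] at hW
    have h1 : (a : ℝ) * w 0 ≤ 0 := mul_nonpos_of_nonneg_of_nonpos a.cast_nonneg (hw 0).le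
    have h2 : (b : ℝ) * w 1 ≤ 0 := mul_nonpos_of_nonneg_of_nonpos b.cast_nonneg (hw 1).le
    have h3 : (s₁ * N.card : ℝ) * w 0 ≤ 0 :=
      mul_nonpos_of_nonneg_of_nonpos (by positivity) (hw 0).le
    have h4 : (m * (s₁ - 2) : ℝ) * w 0 ≤ 0 := by
      refine mul_nonpos_of_nonneg_of_nonpos (mul_nonneg m.cast_nonneg ?_) (hw 0).le
      rw [sub_nonneg]
      exact_mod_cast hs₁2
    linarith

include hν hf in
/-- A lower bound for the values of partial derivatives forces `ν (f₁ R(f₀, f₁)) < ν f₀`, away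
from critical resonance. -/
theorem map_mul_aeval_lt_of_pderiv_bound [IsAlgClosed k] [CharZero k] (hw : ∀ i, w i < 0)
    (h01 : w 0 < w 1)
    (hnc : ∀ (m : ℕ) (l : k), 1 ≤ m → l ≠ 0 → w 0 = m * w 1 →
      ¬ ((w 0 : ℝ) : WithTop ℝ) < ν (f 0 - algebraMap k B l * f 1 ^ m))
    {ε : ℝ} (hε : 0 < ε)
    (hD : ∀ R : MvPolynomial (Fin 2) k,
      ν (aeval f R) + ((w 1 + ε : ℝ) : WithTop ℝ) ≤ ν (aeval f (pderiv 0 R)))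
    {R : MvPolynomial (Fin 2) k} (hR : 0 < R.degreeOf 0) :
    ν (f 1 * aeval f R) < ν (f 0) := by
  have hR0 : R ≠ 0 := by
    rintro rfl
    simp at hR
  obtain ⟨W, hRW, hS0⟩ := exists_weightedHomogeneousComponent_ne_zero w hR0
  obtain ⟨W', hW', hL⟩ := exists_sub_weightedHomogeneousComponent_mem hRW
  set S := weightedHomogeneousComponent w W R
  obtain ⟨m, hm, hm2⟩ := exists_map_aeval_iterate_pderiv_eq hν hf hw hnc
    (weightedHomogeneousComponent_isWeightedHomogeneous (w := w) W R) hS0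
  have hWw : W ≤ w 0 := by
    obtain ⟨I, hI, hI0⟩ : ∃ I ∈ R.support, 0 < I 0 := by
      by_contra! hcon
      exact hR.ne' (Nat.le_zero.1 (degreeOf_le_iff.2 hcon))
    have h1 := mem_weightGE.1 hRW I (mem_support_iff.1 hI)
    rw [weight_fin_two] at h1
    have h2 : (1 : ℝ) ≤ I 0 := by exact_mod_cast hI0
    nlinarith [hw 0, hw 1, mul_nonneg (sub_nonneg.2 h2) (neg_nonneg.2 (hw 0).le),
      mul_nonneg (Nat.cast_nonneg (α := ℝ) (I 1)) (neg_nonneg.2 (hw 1).le)]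
  have hmR : ν (aeval f ((pderiv 0)^[m] R)) = ((W - m * w 0 : ℝ) : WithTop ℝ) := by
    have e : R = S + (R - S) := by ring
    have hlt : ν (aeval f ((pderiv 0)^[m] S)) < ν (aeval f ((pderiv 0)^[m] (R - S))) := by
      rw [hm]
      refine lt_of_lt_of_le (WithTop.coe_lt_coe.2 ?_)
        (le_map_aeval_of_mem_weightGE hν hf (iterate_pderiv_mem_weightGE 0 hL m))
      linarith
    conv_lhs => rw [e]
    rw [iterate_map_add, map_add, ν.map_add_eq_of_lt_left hlt, hm]
  have hiter : ∀ n : ℕ, ν (aeval f R) + ((n * (w 1 + ε) : ℝ) : WithTop ℝ) ≤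
      ν (aeval f ((pderiv 0)^[n] R)) := by
    intro n
    induction n with
    | zero => simp
    | succ n ih =>
      rw [Function.iterate_succ_apply']
      refine le_trans ?_ (hD _)
      have e : ((((n + 1 : ℕ) : ℝ) * (w 1 + ε) : ℝ) : WithTop ℝ) =
          ((n * (w 1 + ε) : ℝ) : WithTop ℝ) + ((w 1 + ε : ℝ) : WithTop ℝ) := by
        rw [← WithTop.coe_add]
        congr 1
        push_cast
        ring
      rw [e, ← add_assoc]
      gcongr
  have h := hiter m
  rw [hmR] at h
  have hne : ν (aeval f R) ≠ ⊤ := by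
    intro htop
    rw [htop, WithTop.top_add, top_le_iff] at h
    exact WithTop.coe_ne_top h
  obtain ⟨r, hr⟩ := WithTop.ne_top_iff_exists.1 hne
  rw [← hr, ← WithTop.coe_add, WithTop.coe_le_coe] at h
  rw [ν.map_mul, hf, hf, ← hr, ← WithTop.coe_add, WithTop.coe_lt_coe]
  rcases hm2 with rfl | hm2
  · simp at h
    linarith [hw 1]
  · rcases Nat.eq_zero_or_pos m with rfl | hm0
    · simp at h
      linarith [hw 1]
    · have h1 : (1 : ℝ) ≤ m := by exact_mod_cast hm0
      nlinarith [mul_nonneg (sub_nonneg.2 h1) (sub_nonneg.2 h01.le),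
        mul_pos (zero_lt_one.trans_le h1) hε]

end Binary

section QuotientValuation

variable {k σ B : Type*} [Field k] [CommRing B] [Algebra k B] {φ : MvPolynomial σ k →ₐ[k] B}
  {w : σ → ℝ} {h : MvPolynomial σ k} {δ : ℝ}

lemma MvPolynomial.IsQuotientWeight.ne_zero {f : B} {v : ℝ} (hv : IsQuotientWeight φ w f v) :
    f ≠ 0 := by
  rintro rfl
  have := hv.2 0 (v + 1) (map_zero φ) (zero_mem _)
  linarith

/-- The monomial valuation with negative weights `w` descends to the quotient by a polynomial whose
lowest-weight part is prime. -/
lemma exists_addValuation_isQuotientWeight [Finite σ] [Nontrivial B] (hw : ∀ i, w i < 0)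
    (hsurj : Function.Surjective φ) (hφ : ∀ R, φ R = 0 ↔ h ∣ R) (hh : h ∈ weightGE w δ)
    (hq : Prime (weightedHomogeneousComponent w δ h)) :
    ∃ ν : AddValuation B (WithTop ℝ), ∀ f v, IsQuotientWeight φ w f v → ν f = (v : WithTop ℝ) := by
  classical
  let V : B → WithTop ℝ := fun f =>
    if hf : ∃ v, IsQuotientWeight φ w f v then ((hf.choose : ℝ) : WithTop ℝ) else ⊤
  have hV : ∀ f v, IsQuotientWeight φ w f v → V f = (v : WithTop ℝ) := by
    intro f v hv
    have hex : ∃ v, IsQuotientWeight φ w f v := ⟨v, hv⟩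
    change (if hf : _ then _ else _) = _
    rw [dif_pos hex, hex.choose_spec.unique hv]
  have h0 : V 0 = ⊤ := dif_neg fun ⟨v, hv⟩ => hv.ne_zero rfl
  have h1 : V 1 = 0 := by
    have := hV _ _ (isQuotientWeight_algebraMap (φ := φ) hw (one_ne_zero (α := k)))
    rwa [map_one] at this
  refine ⟨AddValuation.of V h0 h1 ?_ ?_, hV⟩
  · intro f g
    by_cases hf : f = 0
    · simp [hf]
    by_cases hg : g = 0
    · simp [hg]
    by_cases hfg : f + g = 0
    · simp [hfg, h0]
    obtain ⟨u, hu⟩ := exists_isQuotientWeight hw hsurj hf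
    obtain ⟨v, hv⟩ := exists_isQuotientWeight hw hsurj hg
    obtain ⟨r, hr⟩ := exists_isQuotientWeight hw hsurj hfg
    rw [hV _ _ hu, hV _ _ hv, hV _ _ hr, ← WithTop.coe_min, WithTop.coe_le_coe]
    obtain ⟨R, hR, hRu⟩ := hu.1
    obtain ⟨S, hS, hSv⟩ := hv.1
    exact hr.2 (R + S) _ (by rw [map_add, hR, hS])
      (add_mem (weightGE_anti (min_le_left _ _) hRu) (weightGE_anti (min_le_right _ _) hSv))
  · intro f g
    by_cases hf : f = 0
    · simp [hf, h0]
    by_cases hg : g = 0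
    · simp [hg, h0]
    obtain ⟨u, hu⟩ := exists_isQuotientWeight hw hsurj hf
    obtain ⟨v, hv⟩ := exists_isQuotientWeight hw hsurj hg
    rw [hV _ _ hu, hV _ _ hv, hV _ _ (hu.mul hφ hh hq hv), WithTop.coe_add]

end QuotientValuation

lemma Derivation.map_mvPolynomial_aeval_fin_two {k A : Type*} [CommRing k] [CommRing A]
    [Algebra k A] (D : Derivation k A A) {F : Fin 2 → A} (h1 : D (F 1) = 0)
    (P : MvPolynomial (Fin 2) k) :
    D (aeval F P) = aeval F (pderiv 0 P) * D (F 0) := by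
  induction P using MvPolynomial.induction_on with
  | C a => simp
  | add p q hp hq => simp only [map_add, hp, hq, add_mul]
  | mul_X p i hp =>
    rw [map_mul, aeval_X, Derivation.leibniz, hp, Derivation.leibniz, map_add, smul_eq_mul,
      smul_eq_mul, smul_eq_mul, smul_eq_mul, map_mul, map_mul, aeval_X]
    fin_cases i
    · simp
      ring
    · have : pderiv (0 : Fin 2) (X 1 : MvPolynomial (Fin 2) k) = 0 :=
        pderiv_X_of_ne (by decide)
      simp [this, h1]
      ring

section JacobianBound

variable {k : Type} {B : Type*} [Field k] [CommRing B] [Algebra k B]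
  {φ : MvPolynomial (Fin 4) k →ₐ[k] B} {α : Fin 4 → ℝ} {h : MvPolynomial (Fin 4) k} {δ : ℝ}

/-- The Jacobian derivation `Jac(h, F₁, xᵢ, ·)` bounds the valuation of partial derivatives of
polynomials in `F₀`, `F₁`. -/
lemma map_aeval_pderiv_ge_of_jac (hα : ∀ i, α i < 0) (hsurj : Function.Surjective φ)
    (hφ : ∀ R, φ R = 0 ↔ h ∣ R) (hh : h ∈ weightGE α δ) {ν : AddValuation B (WithTop ℝ)}
    (hν : ∀ f v, IsQuotientWeight φ α f v → ν f = (v : WithTop ℝ))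
    {F : Fin 2 → MvPolynomial (Fin 4) k} {u : ℝ} (hF : F 1 ∈ weightGE α u) {i : Fin 4}
    (hne : φ (jac k ![h, F 1, X i, F 0]) ≠ 0) (P : MvPolynomial (Fin 2) k) :
    ν (aeval (fun j => φ (F j)) P) + ((u + (δ + α i - ∑ j, α j) : ℝ) : WithTop ℝ) ≤
      ν (aeval (fun j => φ (F j)) (pderiv 0 P)) := by
  have hφF : ∀ P : MvPolynomial (Fin 2) k, φ (aeval F P) = aeval (fun j => φ (F j)) P := by
    intro P
    rw [← AlgHom.comp_apply, comp_aeval]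
  have hlow : ∀ R c, R ∈ weightGE α c → (c : WithTop ℝ) ≤ ν (φ R) := by
    intro R c hR
    by_cases h0 : φ R = 0
    · simp [h0]
    obtain ⟨v, hv⟩ := exists_isQuotientWeight hα hsurj h0
    rw [hν _ _ hv]
    exact WithTop.coe_le_coe.2 (hv.2 R c rfl hR)
  have hd1 : jacDeriv h (F 1) (X i) (F 1) = 0 := by
    rw [jacDeriv_apply]
    exact jac_eq_zero (show (1 : Fin 4) ≠ 3 by decide) rfl
  rw [← jacDeriv_apply] at hne
  have hchain : ∀ G, φ G = aeval (fun j => φ (F j)) P → φ (jacDeriv h (F 1) (X i) G) =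
      aeval (fun j => φ (F j)) (pderiv 0 P) * φ (jacDeriv h (F 1) (X i) (F 0)) := by
    intro G hG
    rw [← hφF, ← map_mul, ← Derivation.map_mvPolynomial_aeval_fin_two _ hd1]
    exact map_jacDeriv_congr hφ _ _ (hG.trans (hφF P).symm)
  obtain ⟨e, he⟩ := exists_isQuotientWeight hα hsurj hne
  have he0 := he.nonpos hα hne
  have hle : ∀ G, φ G = aeval (fun j => φ (F j)) P → ν (φ (jacDeriv h (F 1) (X i) G)) ≤
      ν (aeval (fun j => φ (F j)) (pderiv 0 P)) := by
    intro G hG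
    rw [hchain G hG, ν.map_mul, hν _ _ he]
    exact add_le_of_nonpos_right (by exact_mod_cast he0)
  by_cases h0 : aeval (fun j => φ (F j)) P = 0
  · have := hle 0 (by rw [h0, map_zero])
    rw [map_zero, map_zero, ν.map_zero, top_le_iff] at this
    rw [this]
    exact le_top
  obtain ⟨c, hc⟩ := exists_isQuotientWeight hα hsurj h0
  obtain ⟨G, hG, hGc⟩ := hc.1
  refine le_trans ?_ (hle G hG)
  rw [hν _ _ hc, ← WithTop.coe_add]
  refine hlow _ _ ?_
  rw [jacDeriv_apply]
  have := jac_mem_weightGE (w := α) (R := ![h, F 1, X i, G]) (c := ![δ, u, α i, c]) (by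
    intro j
    fin_cases j
    · exact hh
    · exact hF
    · exact X_mem_weightGE i
    · exact hGc)
  refine weightGE_anti (le_of_eq ?_) this
  simp [Fin.sum_univ_four]
  ring

end JacobianBound

section Quadric

variable {k : Type} [Field k]

/-- The change of coordinates translating the point `p` to the origin. -/
def shiftTo (p : Fin 4 → k) : MvPolynomial (Fin 4) k ≃ₐ[k] MvPolynomial (Fin 4) k :=
  AlgEquiv.ofAlgHom (aeval fun i => X i + C (p i)) (aeval fun i => X i - C (p i))
    (by ext i : 1; simp [algebraMap_eq]) (by ext i : 1; simp [algebraMap_eq])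

lemma shiftTo_apply (p : Fin 4 → k) (R : MvPolynomial (Fin 4) k) :
    shiftTo p R = aeval (fun i => X i + C (p i)) R := rfl

/-- The projection onto `k[Q]` in coordinates centered at `p`. -/
def qmkAt (p : Fin 4 → k) : MvPolynomial (Fin 4) k →ₐ[k] QuadRing k :=
  (Ideal.Quotient.mkₐ k (Ideal.span {qpoly k - 1})).comp (shiftTo p).symm.toAlgHom

lemma qmkAt_shiftTo (p : Fin 4 → k) (R : MvPolynomial (Fin 4) k) :
    qmkAt p (shiftTo p R) = qmk k R := by
  change qmk k ((shiftTo p).symm (shiftTo p R)) = qmk k R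
  rw [AlgEquiv.symm_apply_apply]

lemma qmkAt_surjective (p : Fin 4 → k) : Function.Surjective (qmkAt p) :=
  (Ideal.Quotient.mkₐ_surjective k _).comp (shiftTo p).symm.surjective

lemma qmkAt_eq_zero_iff (p : Fin 4 → k) (R : MvPolynomial (Fin 4) k) :
    qmkAt p R = 0 ↔ shiftTo p (qpoly k - 1) ∣ R := by
  change Ideal.Quotient.mk _ ((shiftTo p).symm R) = 0 ↔ _
  rw [Ideal.Quotient.eq_zero_iff_mem, Ideal.mem_span_singleton,
    ← map_dvd_iff (shiftTo p), AlgEquiv.apply_symm_apply]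

lemma shiftTo_qpoly_sub_one (p : Fin 4 → k) :
    shiftTo p (qpoly k - 1) = X 0 * X 3 - X 1 * X 2 + (C (p 3) * X 0 + C (p 0) * X 3 -
      C (p 2) * X 1 - C (p 1) * X 2 + C (p 0 * p 3 - p 1 * p 2 - 1)) := by
  rw [shiftTo_apply, qpoly]
  simp only [map_sub, map_mul, map_one, aeval_X]
  ring

lemma prime_qpoly : Prime (qpoly k) := by
  refine Irreducible.prime ?_
  have e : qpoly k = X 0 * X 3 + -(X 1 * X 2) := by
    rw [qpoly, sub_eq_add_neg]
  rw [e]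
  refine irreducible_mul_X_add _ _ _ (X_ne_zero _) ?_ ?_ ?_
  · rw [vars_X]
    decide
  · rw [vars_neg]
    intro hmem
    have := vars_mul _ _ hmem
    rw [vars_X, vars_X] at this
    revert this
    decide
  · refine ((X_prime (i := (0 : Fin 4))).irreducible.isRelPrime_iff_not_dvd).2 fun hdvd => ?_
    simpa using map_dvd (eval ![(0 : k), 1, 1, 0]) hdvd

variable {α : Fin 4 → ℝ}

lemma shiftTo_mem_weightGE (hα : ∀ i, α i < 0) (hsum : α 0 + α 3 = α 1 + α 2) (p : Fin 4 → k) :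
    shiftTo p (qpoly k - 1) ∈ weightGE α (α 0 + α 3) := by
  have hX : ∀ i (a : k), C a * X i ∈ weightGE α (α i) := fun i a => by
    rw [C_mul']
    exact Submodule.smul_mem _ _ (X_mem_weightGE i)
  have := hα 0
  have := hα 1
  have := hα 2
  have := hα 3
  rw [shiftTo_qpoly_sub_one]
  refine add_mem (sub_mem ?_ ?_) (add_mem (sub_mem (sub_mem (add_mem ?_ ?_) ?_) ?_) ?_)
  · exact mul_mem_weightGE (X_mem_weightGE 0) (X_mem_weightGE 3)
  · exact weightGE_anti hsum.le (mul_mem_weightGE (X_mem_weightGE 1) (X_mem_weightGE 2))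
  · exact weightGE_anti (by linarith) (hX _ _)
  · exact weightGE_anti (by linarith) (hX _ _)
  · exact weightGE_anti (by linarith) (hX _ _)
  · exact weightGE_anti (by linarith) (hX _ _)
  · exact weightGE_anti (by linarith) (C_mem_weightGE _)

lemma weightedHomogeneousComponent_shiftTo (hα : ∀ i, α i < 0)
    (hsum : α 0 + α 3 = α 1 + α 2) (p : Fin 4 → k) :
    weightedHomogeneousComponent α (α 0 + α 3) (shiftTo p (qpoly k - 1)) = qpoly k := by
  have hX : ∀ i (a : k), α 0 + α 3 < α i →
      weightedHomogeneousComponent α (α 0 + α 3) (C a * X i) = 0 := fun i a hi => by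
    refine weightedHomogeneousComponent_eq_zero_of_lt hi ?_
    rw [C_mul']
    exact Submodule.smul_mem _ _ (X_mem_weightGE i)
  have := hα 0
  have := hα 1
  have := hα 2
  have := hα 3
  have hC : ∀ a : k, weightedHomogeneousComponent α (α 0 + α 3) (C a) = 0 := fun a =>
    weightedHomogeneousComponent_eq_zero_of_lt (by linarith) (C_mem_weightGE a)
  have hq : IsWeightedHomogeneous α (X 0 * X 3 - X 1 * X 2 : MvPolynomial (Fin 4) k)
      (α 0 + α 3) := by
    refine ((isWeightedHomogeneous_X k α 0).mul (isWeightedHomogeneous_X k α 3)).sub ?_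
    rw [hsum]
    exact (isWeightedHomogeneous_X k α 1).mul (isWeightedHomogeneous_X k α 2)
  rw [shiftTo_qpoly_sub_one, map_add, hq.weightedHomogeneousComponent_same, map_add, map_sub,
    map_sub, map_add, hX, hX, hX, hX, hC, qpoly]
  · ring
  all_goals linarith

lemma le_mvalP_iff (p : Fin 4 → k) (R : MvPolynomial (Fin 4) k) (c : ℝ) :
    (c : WithTop ℝ) ≤ mvalP k p α R ↔ shiftTo p R ∈ weightGE α c := by
  rw [mvalP, Finset.le_inf_iff, mem_weightGE, shiftTo_apply]
  refine forall_congr' fun I => ?_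
  rw [mem_support_iff, WithTop.coe_le_coe, Finsupp.weight_apply,
    Finsupp.sum_fintype _ _ (by simp)]
  simp only [nsmul_eq_mul, mul_comm]

lemma nuSup_eq_of_isQuotientWeight {p : Fin 4 → k} {f : QuadRing k} {v : ℝ}
    (hv : IsQuotientWeight (qmkAt p) α f v) : nuSup k p α f = (v : WithTop ℝ) := by
  have hub : ∀ R, qmk k R = f → mvalP k p α R ≤ (v : WithTop ℝ) := by
    intro R hR
    have h : ∀ c : ℝ, (c : WithTop ℝ) ≤ mvalP k p α R → c ≤ v := fun c hc =>
      hv.2 _ _ ((qmkAt_shiftTo p R).trans hR) ((le_mvalP_iff p R c).1 hc)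
    induction hm : mvalP k p α R using WithTop.recTopCoe with
    | top =>
      have := h (v + 1) (hm ▸ le_top)
      linarith
    | coe c => exact WithTop.coe_le_coe.2 (h c hm.ge)
  obtain ⟨R, hR, hRv⟩ := hv.1
  have hR' : shiftTo p ((shiftTo p).symm R) = R := AlgEquiv.apply_symm_apply _ _
  have hqR : qmk k ((shiftTo p).symm R) = f := by rw [← qmkAt_shiftTo p, hR', hR]
  have hmax : IsGreatest {v : WithTop ℝ | ∃ R : MvPolynomial (Fin 4) k, qmk k R = f ∧
      mvalP k p α R = v} (v : WithTop ℝ) := by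
    refine ⟨⟨_, hqR, le_antisymm (hub _ hqR) ?_⟩, ?_⟩
    · rw [le_mvalP_iff, hR']
      exact hRv
    · rintro _ ⟨S, hS, rfl⟩
      exact hub S hS
  exact (WithTop.isLUB_sSup' hmax.nonempty).unique hmax.isLUB

lemma nuSup_zero (p : Fin 4 → k) : nuSup k p α 0 = ⊤ :=
  WithTop.sSup_of_top_mem ⟨0, map_zero _, by simp [mvalP]⟩

/-- Evaluation of regular functions at the point `(1, s, 0, 1)` of the quadric. -/
def evalQuad (s : k) : QuadRing k →+* k :=
  Ideal.Quotient.lift _ (eval ![1, s, 0, 1]) fun R hR => by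
    obtain ⟨S, rfl⟩ := Ideal.mem_span_singleton.1 hR
    simp [qpoly]

lemma evalQuad_qmk (s : k) (R : MvPolynomial (Fin 4) k) :
    evalQuad s (qmk k R) = eval ![1, s, 0, 1] R := rfl

instance : Nontrivial (QuadRing k) :=
  (evalQuad (0 : k)).domain_nontrivial

lemma qmk_X_zero_ne_zero : qmk k (X 0) ≠ 0 := fun h => by
  simpa [evalQuad_qmk] using congrArg (evalQuad 0) h

lemma qmk_X_one_ne_zero : qmk k (X 1) ≠ 0 := fun h => by
  simpa [evalQuad_qmk] using congrArg (evalQuad 1) h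

/-- Every element of `𝒱₀` is an additive valuation, computed by optimal lifts. -/
lemma exists_addValuation_nuSup (hα : ∀ i, α i < 0) (hsum : α 0 + α 3 = α 1 + α 2)
    (p : Fin 4 → k) :
    ∃ ν : AddValuation (QuadRing k) (WithTop ℝ), (∀ f, ν f = nuSup k p α f) ∧
      ∀ f v, IsQuotientWeight (qmkAt p) α f v → ν f = (v : WithTop ℝ) := by
  obtain ⟨ν, hν⟩ := exists_addValuation_isQuotientWeight hα (qmkAt_surjective p)
    (qmkAt_eq_zero_iff p) (shiftTo_mem_weightGE hα hsum p)
    (by rw [weightedHomogeneousComponent_shiftTo hα hsum]; exact prime_qpoly)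
  refine ⟨ν, fun f => ?_, hν⟩
  by_cases hf : f = 0
  · rw [hf, ν.map_zero, nuSup_zero]
  obtain ⟨v, hv⟩ := exists_isQuotientWeight hα (qmkAt_surjective p) hf
  rw [hν _ _ hv, nuSup_eq_of_isQuotientWeight hv]

lemma pderiv_shiftTo_qpoly_sub_one (p : Fin 4 → k) :
    pderiv 3 (shiftTo p (qpoly k - 1)) = shiftTo p (X 0) := by
  have h0 : pderiv (3 : Fin 4) (X 0 : MvPolynomial (Fin 4) k) = 0 := pderiv_X_of_ne (by decide)
  have h1 : pderiv (3 : Fin 4) (X 1 : MvPolynomial (Fin 4) k) = 0 := pderiv_X_of_ne (by decide)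
  have h2 : pderiv (3 : Fin 4) (X 2 : MvPolynomial (Fin 4) k) = 0 := pderiv_X_of_ne (by decide)
  rw [shiftTo_qpoly_sub_one, shiftTo_apply, aeval_X]
  simp only [map_add, map_sub, Derivation.leibniz, pderiv_X_self, h0, h1, h2, pderiv_C, smul_eq_mul]
  ring

/-- Coordinates of an automorphism of `Q` have a nonvanishing Jacobian with the equation of `Q`
and one of the coordinate functions. -/
lemma exists_jac_ne_zero_of_algEquiv [NoZeroDivisors (QuadRing k)] (p : Fin 4 → k)
    (σ : QuadRing k ≃ₐ[k] QuadRing k) {F₀ F₁ : MvPolynomial (Fin 4) k}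
    (h0 : qmkAt p F₀ = σ (qmk k (X 0))) (h1 : qmkAt p F₁ = σ (qmk k (X 1))) :
    ∃ i, qmkAt p (jac k ![shiftTo p (qpoly k - 1), F₁, X i, F₀]) ≠ 0 := by
  obtain ⟨F₂, h2⟩ := qmkAt_surjective p (σ (qmk k (X 2)))
  obtain ⟨F₃, h3⟩ := qmkAt_surjective p (σ (qmk k (X 3)))
  have hF : (qmkAt p).comp (aeval ![F₀, F₁, F₂, F₃]) =
      σ.toAlgHom.comp (Ideal.Quotient.mkₐ k (Ideal.span {qpoly k - 1})) := by
    refine algHom_ext fun i => ?_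
    rw [AlgHom.comp_apply, aeval_X]
    fin_cases i
    · exact h0
    · exact h1
    · exact h2
    · exact h3
  have hF' : ∀ P, qmkAt p (aeval ![F₀, F₁, F₂, F₃] P) = σ (qmk k P) := fun P =>
    DFunLike.congr_fun hF P
  refine exists_map_jac_X_ne_zero (F := ![F₀, F₁, F₂, F₃]) (qmkAt_eq_zero_iff p) (fun G => ?_)
    ?_ ?_ ?_ ?_
  · obtain ⟨P, hP⟩ := Ideal.Quotient.mk_surjective (σ.symm (qmkAt p G))
    refine ⟨P, (hF' P).trans ?_⟩
    rw [qmk, hP, AlgEquiv.apply_symm_apply]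
  · have hq := hF' (qpoly k)
    have e : qmk k (qpoly k) = 1 := by
      rw [← sub_eq_zero, ← map_one (qmk k), ← map_sub]
      exact Ideal.Quotient.eq_zero_iff_mem.2 (Ideal.mem_span_singleton_self _)
    have e' : aeval ![F₀, F₁, F₂, F₃] (qpoly k) = F₀ * F₃ - F₁ * F₂ := by simp [qpoly]
    rw [e, map_one, e'] at hq
    exact hq.trans (map_one (qmkAt p)).symm
  · change qmkAt p F₀ ≠ 0
    rw [h0]
    exact (map_ne_zero_iff σ σ.injective).2 qmk_X_zero_ne_zero
  · change qmkAt p F₁ ≠ 0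
    rw [h1]
    exact (map_ne_zero_iff σ σ.injective).2 qmk_X_one_ne_zero
  · rw [pderiv_shiftTo_qpoly_sub_one, qmkAt_shiftTo]
    exact qmk_X_zero_ne_zero

end Quadric

/-- Corollary 4.19: let `ν ∈ 𝒱₀` and let `(f₁, f₂)` be a component of
an automorphism of `Q` with `ν(f₁) < ν(f₂)` which is not critically resonant with
respect to `ν`. Then for every polynomial `R ∈ k[X,Y] ∖ k[Y]` (i.e. of positive degree
in `X`), one has `ν(f₂ · R(f₁,f₂)) < ν(f₁)`. -/
theorem val_mul_lt_of_not_criticallyResonant (k : Type) [Field k] [IsAlgClosed k]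
    [CharZero k]
    (ν : QuadRing k → WithTop ℝ) (hν : ν ∈ V0 k)
    (f1 f2 : QuadRing k) (hcomp : IsComponent k f1 f2)
    (hlt : ν f1 < ν f2)
    (hcrit : ¬ CriticallyResonant k ν f1 f2) :
    ∀ R : MvPolynomial (Fin 2) k, 0 < R.degreeOf 0 →
      ν (f2 * MvPolynomial.aeval ![f1, f2] R) < ν f1 := by
  obtain ⟨p, α, hα, hsum, rfl⟩ := hν
  obtain ⟨σ, rfl, rfl⟩ := hcomp
  obtain ⟨ν, hνeq, hνq⟩ := exists_addValuation_nuSup hα hsum p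
  have hquot : ∀ f : QuadRing k, f ≠ 0 → ∃ v, IsQuotientWeight (qmkAt p) α f v :=
    fun f hf => exists_isQuotientWeight hα (qmkAt_surjective p) hf
  have hdom : NoZeroDivisors (QuadRing k) := ⟨fun {a b} hab => by
    by_contra! hne
    obtain ⟨u, hu⟩ := hquot a hne.1
    obtain ⟨v, hv⟩ := hquot b hne.2
    have := congrArg ν hab
    rw [ν.map_mul, ν.map_zero, hνq _ _ hu, hνq _ _ hv, ← WithTop.coe_add] at this
    exact WithTop.coe_ne_top this⟩
  have hne0 := (map_ne_zero_iff σ σ.injective).2 (qmk_X_zero_ne_zero (k := k))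
  have hne1 := (map_ne_zero_iff σ σ.injective).2 (qmk_X_one_ne_zero (k := k))
  obtain ⟨w₀, hw₀⟩ := hquot _ hne0
  obtain ⟨w₁, hw₁⟩ := hquot _ hne1
  obtain ⟨F₀, hF₀, -⟩ := hw₀.1
  obtain ⟨F₁, hF₁, hF₁w⟩ := hw₁.1
  obtain ⟨i, hi⟩ := exists_jac_ne_zero_of_algEquiv p σ hF₀ hF₁
  rw [← hνeq, ← hνeq, hνq _ _ hw₀, hνq _ _ hw₁, WithTop.coe_lt_coe] at hlt
  have hw₁neg : w₁ < 0 := by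
    refine lt_of_le_of_ne (hw₁.nonpos hα hne1) ?_
    rintro rfl
    refine hi ?_
    rw [eq_C_of_mem_weightGE_zero hα hF₁w, jac, Matrix.det_eq_zero_of_row_eq_zero 1, map_zero]
    intro j
    exact pderiv_C
  intro R hR
  have hf : (![σ (qmk k (X 0)), σ (qmk k (X 1))] : Fin 2 → QuadRing k) =
      fun j => qmkAt p (![F₀, F₁] j) := by
    ext j
    fin_cases j
    · exact hF₀.symm
    · exact hF₁.symm
  rw [← hνeq, ← hνeq]
  have hαi : 0 < α i - (α 0 + α 3) := by
    have := hα 0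
    have := hα 1
    have := hα 2
    have := hα 3
    fin_cases i <;> simp <;> linarith
  refine map_mul_aeval_lt_of_pderiv_bound (f := ![σ (qmk k (X 0)), σ (qmk k (X 1))])
    (w := ![w₀, w₁]) (fun a ha => hνq _ _ (isQuotientWeight_algebraMap hα ha)) ?_ ?_ hlt ?_ hαi
    (fun P => ?_) hR
  · intro j
    fin_cases j
    · exact hνq _ _ hw₀
    · exact hνq _ _ hw₁
  · intro j
    fin_cases j
    · exact hlt.trans hw₁neg
    · exact hw₁neg
  · intro m l hm hl hres hval
    refine hcrit (Or.inl ⟨m, l, hm, hl, ?_, ?_⟩)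
    · rw [← hνeq, ← hνeq, hνq _ _ hw₀]
      exact hval
    · rw [← hνeq, ← hνeq, hνq _ _ hw₀, hνq _ _ hw₁, ← WithTop.coe_nsmul, nsmul_eq_mul]
      exact congrArg _ hres
  · rw [hf]
    have := map_aeval_pderiv_ge_of_jac (F := ![F₀, F₁]) hα (qmkAt_surjective p)
      (qmkAt_eq_zero_iff p) (shiftTo_mem_weightGE hα hsum p) hνq hF₁w hi P
    have e : w₁ + (α 0 + α 3 + α i - ∑ j, α j) = w₁ + (α i - (α 0 + α 3)) := by
      rw [Fin.sum_univ_four]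
      linear_combination hsum
    rwa [e] at this
end
end

section
/- Let ν ∈ 𝒱₀ satisfy max(ν(y) + ν(t), ν(z) + ν(t)) < ν(x) < min(ν(y), ν(z), ν(t)). Then for every nonconstant polynomial P ∈ k[X,Y]: (a) ν(y) < ν(t), ν(x + y·P(y,t)) < ν(t), and ν(z + t·P(y,t)) < ν(y); and (b) ν(z) < ν(t), ν(x + z·P(z,t)) < ν(t), and ν(y + t·P(z,t)) < ν(z). -/
noncomputable section

open MvPolynomial

/-- Every monomial occurring in the Laurent polynomial `f` has weight at least `c`. -/
def WeightGE {k G : Type} [Field k] [AddCommGroup G] (w : G →+ ℝ) (c : ℝ)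
    (f : AddMonoidAlgebra k G) : Prop :=
  ∀ m, f.coeff m ≠ 0 → c ≤ w m

namespace WeightGE

variable {k G : Type} [Field k] [AddCommGroup G] {w : G →+ ℝ} {c d : ℝ}
  {f g : AddMonoidAlgebra k G}

theorem mono (hf : WeightGE w c f) (h : d ≤ c) : WeightGE w d f :=
  fun m hm => h.trans (hf m hm)

theorem add (hf : WeightGE w c f) (hg : WeightGE w c g) : WeightGE w c (f + g) := by
  intro m hm
  by_cases h : f.coeff m = 0
  · refine hg m fun h' => hm ?_
    simp [h, h']
  · exact hf m h

theorem neg (hf : WeightGE w c f) : WeightGE w c (-f) := by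
  intro m hm
  refine hf m fun h' => hm ?_
  simp [h']

theorem single (m : G) (a : k) : WeightGE w (w m) (AddMonoidAlgebra.single m a) := by
  classical
  intro n hn
  have : m = n := by
    by_contra h
    exact hn (by simp [h])
  rw [this]

theorem algebraMap (a : k) : WeightGE w 0 (algebraMap k (AddMonoidAlgebra k G) a) := by
  have := WeightGE.single (w := w) (0 : G) a
  rwa [map_zero] at this

theorem mul (hf : WeightGE w c f) (hg : WeightGE w d g) : WeightGE w (c + d) (f * g) := by
  classical
  intro m hm
  have := AddMonoidAlgebra.support_coeff_mul_subset f g (Finsupp.mem_support_iff.2 hm)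
  obtain ⟨a, ha, b, hb, rfl⟩ := Finset.mem_add.1 this
  rw [map_add]
  exact add_le_add (hf a (Finsupp.mem_support_iff.1 ha)) (hg b (Finsupp.mem_support_iff.1 hb))

theorem pow (hf : WeightGE w c f) (n : ℕ) : WeightGE w (c * n) (f ^ n) := by
  induction n with
  | zero => simpa [AddMonoidAlgebra.one_def] using WeightGE.algebraMap (w := w) (1 : k)
  | succ n ih =>
    rw [pow_succ]
    exact (ih.mul hf).mono (by push_cast; linarith)

theorem prod {ι : Type} (s : Finset ι) (c : ι → ℝ) (f : ι → AddMonoidAlgebra k G)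
    (h : ∀ i, WeightGE w (c i) (f i)) : WeightGE w (∑ i ∈ s, c i) (∏ i ∈ s, f i) := by
  classical
  induction s using Finset.induction_on with
  | empty => simpa [AddMonoidAlgebra.one_def] using WeightGE.algebraMap (w := w) (1 : k)
  | insert a s ha ih =>
    rw [Finset.sum_insert ha, Finset.prod_insert ha]
    exact (h a).mul ih

end WeightGE

theorem isLUB_nuSup (k : Type) [Field k] (p : Fin 4 → k) (α : Fin 4 → ℝ) (f : QuadRing k) :
    IsLUB {v : WithTop ℝ | ∃ R : MvPolynomial (Fin 4) k, qmk k R = f ∧ mvalP k p α R = v}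
      (nuSup k p α f) := by
  obtain ⟨R, hR⟩ := Ideal.Quotient.mk_surjective f
  exact WithTop.isLUB_sSup' ⟨_, R, hR, rfl⟩

/-- A homomorphism to a Laurent polynomial ring compatible with the weights bounds `nuSup`
from above by the weights of the monomials in the image. -/
theorem nuSup_le_weight {k G : Type} [Field k] [AddCommGroup G] (w : G →+ ℝ)
    (p : Fin 4 → k) {α : Fin 4 → ℝ} (hα : ∀ i, α i < 0)
    (Φ : QuadRing k →ₐ[k] AddMonoidAlgebra k G)
    (hΦ : ∀ i, WeightGE w (α i) (Φ (qmk k (X i)))) (f : QuadRing k) (m : G)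
    (hm : (Φ f).coeff m ≠ 0) : nuSup k p α f ≤ (w m : ℝ) := by
  refine (isLUB_nuSup k p α f).2 ?_
  rintro _ ⟨R, rfl, rfl⟩
  set S : MvPolynomial (Fin 4) k := MvPolynomial.aeval (fun i => X i + C (p i)) R with hS
  let Ψ : MvPolynomial (Fin 4) k →ₐ[k] AddMonoidAlgebra k G :=
    Φ.comp (Ideal.Quotient.mkₐ k (Ideal.span {qpoly k - 1}))
  have hΨX (i : Fin 4) : Ψ (X i) = Φ (qmk k (X i)) := rfl
  let u : Fin 4 → AddMonoidAlgebra k G := fun i => Ψ (X i) + -algebraMap k _ (p i)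
  have hu (i : Fin 4) : WeightGE w (α i) (u i) :=
    WeightGE.add (hΦ i) ((WeightGE.algebraMap (p i)).neg.mono (hα i).le)
  have hR : Φ (qmk k R) = MvPolynomial.aeval u S := by
    have : Ψ = (MvPolynomial.aeval u).comp (MvPolynomial.aeval fun i => X i + C (p i)) := by
      ext i : 1
      simp [u]
    exact DFunLike.congr_fun this R
  rw [hR, MvPolynomial.aeval_def, MvPolynomial.eval₂_eq', AddMonoidAlgebra.coeff_sum,
    Finsupp.finsetSum_apply] at hm
  obtain ⟨d, hd, hdm⟩ := Finset.exists_ne_zero_of_sum_ne_zero hm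
  refine (Finset.inf_le (f := fun I : Fin 4 →₀ ℕ =>
    ((∑ i, α i * (I i : ℝ) : ℝ) : WithTop ℝ)) hd).trans ?_
  have := (WeightGE.algebraMap (w := w) (S.coeff d)).mul
    (WeightGE.prod Finset.univ _ _ fun i => (hu i).pow (d i))
  exact WithTop.coe_le_coe.2 (by simpa using this m hdm)

/-- The weight of a Laurent monomial. -/
def laurentWeight (α : Fin 4 → ℝ) : (Fin 4 → ℤ) →+ ℝ where
  toFun m := ∑ i, α i * (m i : ℝ)
  map_zero' := by simp
  map_add' a b := by simp [mul_add, Finset.sum_add_distrib]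

theorem laurentWeight_single (α : Fin 4 → ℝ) (i : Fin 4) (n : ℤ) :
    laurentWeight α (Pi.single i n) = α i * n := by
  simp [laurentWeight, Pi.single_apply]

/-- The exponent of the `i`-th variable. -/
abbrev expo (i : Fin 4) : Fin 4 → ℤ := Pi.single i 1

/-- The `i`-th variable of the Laurent polynomial ring. -/
abbrev lvar (k : Type) [Field k] (i : Fin 4) : AddMonoidAlgebra k (Fin 4 → ℤ) :=
  AddMonoidAlgebra.single (expo i) 1

theorem exists_quadRing_hom {k A : Type} [Field k] [CommRing A] [Algebra k A] (u : Fin 4 → A)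
    (hu : u 0 * u 3 - u 1 * u 2 = 1) :
    ∃ Φ : QuadRing k →ₐ[k] A, ∀ i, Φ (qmk k (X i)) = u i := by
  refine ⟨Ideal.Quotient.liftₐ _ (MvPolynomial.aeval u) fun a ha => ?_, fun i => ?_⟩
  · refine (Ideal.span_le (I := RingHom.ker (MvPolynomial.aeval (R := k) u))).2 ?_ ha
    simp [qpoly, RingHom.mem_ker, hu]
  · exact MvPolynomial.aeval_X (R := k) u i

/-- Solving `xt - yz = 1` for the `c`-th variable embeds `k[Q]` in a Laurent polynomial ring
compatibly with all weights `α` satisfying `α₀ + α₃ = α₁ + α₂`. -/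
theorem exists_laurent_hom (k : Type) [Field k] (c : Fin 4) (hc : c ≠ 3) :
    ∃ Φ : QuadRing k →ₐ[k] AddMonoidAlgebra k (Fin 4 → ℤ),
      (∀ i, i ≠ c → Φ (qmk k (X i)) = lvar k i) ∧
      ∀ (p : Fin 4 → k) (α : Fin 4 → ℝ), (∀ i, α i < 0) → α 0 + α 3 = α 1 + α 2 →
        ∀ (f : QuadRing k) (m : Fin 4 → ℤ), (Φ f).coeff m ≠ 0 →
          nuSup k p α f ≤ (laurentWeight α m : ℝ) := by
  obtain ⟨c', a, b, s, hu, hadd⟩ : ∃ (c' a b : Fin 4) (s : k),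
      (let u := Function.update (lvar k) c
        (AddMonoidAlgebra.single (expo a + expo b - expo c') 1 +
          AddMonoidAlgebra.single (-expo c') s)
      u 0 * u 3 - u 1 * u 2 = 1) ∧
      ∀ α : Fin 4 → ℝ, α 0 + α 3 = α 1 + α 2 → α c + α c' = α a + α b := by
    fin_cases c
    · refine ⟨3, 1, 2, 1, ?_, fun α h => h⟩
      simp [add_mul, AddMonoidAlgebra.single_mul_single, AddMonoidAlgebra.one_def]
    · refine ⟨2, 0, 3, -1, ?_, fun α h => h.symm⟩
      simp [add_mul, AddMonoidAlgebra.single_mul_single, AddMonoidAlgebra.one_def]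
    · refine ⟨1, 0, 3, -1, ?_, fun α h => by simp; linarith⟩
      simp [mul_add, AddMonoidAlgebra.single_mul_single, AddMonoidAlgebra.one_def]
    · exact absurd rfl hc
  obtain ⟨Φ, hΦ⟩ := exists_quadRing_hom (k := k) _ hu
  refine ⟨Φ, fun i hi => by rw [hΦ, Function.update_of_ne hi], fun p α hα h => ?_⟩
  refine nuSup_le_weight (laurentWeight α) p hα Φ fun i => ?_
  rw [hΦ]
  by_cases hi : i = c
  · subst hi
    have := hadd α h
    rw [Function.update_self]
    refine ((WeightGE.single _ _).mono ?_).add ((WeightGE.single _ _).mono ?_)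
    · simp only [map_add, map_sub, laurentWeight_single]
      push_cast
      linarith
    · simp only [map_neg, laurentWeight_single]
      push_cast
      linarith [hα i, hα c']
  · rw [Function.update_of_ne hi]
    exact (WeightGE.single _ _).mono (by simp [laurentWeight_single])

theorem nuSup_X (k : Type) [Field k] (p : Fin 4 → k) (α : Fin 4 → ℝ) (hα : ∀ i, α i < 0)
    (h : α 0 + α 3 = α 1 + α 2) (i : Fin 4) : nuSup k p α (qmk k (X i)) = (α i : ℝ) := by
  classical
  apply le_antisymm
  · obtain ⟨c, hc, hi⟩ : ∃ c : Fin 4, c ≠ 3 ∧ i ≠ c := by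
      revert i
      decide
    obtain ⟨Φ, hΦ, hle⟩ := exists_laurent_hom k c hc
    have := hle p α hα h (qmk k (X i)) (expo i) (by simp [hΦ i hi])
    simpa [laurentWeight_single] using this
  · refine le_trans ?_ ((isLUB_nuSup k p α (qmk k (X i))).1 ⟨X i, rfl, rfl⟩)
    refine Finset.le_inf fun I hI => WithTop.coe_le_coe.2 ?_
    rw [MvPolynomial.aeval_X] at hI
    rcases Finset.mem_union.1 (MvPolynomial.support_add hI) with hI | hI
    · rw [MvPolynomial.support_X, Finset.mem_singleton] at hI
      simp [hI, Finsupp.single_apply]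
    · rw [Finset.mem_singleton.1 (MvPolynomial.support_monomial_subset hI)]
      simpa using (hα i).le

theorem aeval_lvar_coeff {k : Type} [Field k] (a b : Fin 4) (P : MvPolynomial (Fin 2) k)
    (m : Fin 4 → ℤ) :
    (MvPolynomial.aeval ![lvar k a, lvar k b] P).coeff m =
      ∑ d ∈ P.support, if d 0 • expo a + d 1 • expo b = m then P.coeff d else 0 := by
  classical
  rw [MvPolynomial.aeval_def, MvPolynomial.eval₂_eq', AddMonoidAlgebra.coeff_sum,
    Finsupp.finsetSum_apply]
  refine Finset.sum_congr rfl fun d _ => ?_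
  simp [AddMonoidAlgebra.single_pow, AddMonoidAlgebra.single_mul_single, Finsupp.single_apply]

theorem aeval_lvar_coeff_of_mem {k : Type} [Field k] {a b : Fin 4} (hab : a ≠ b)
    (P : MvPolynomial (Fin 2) k) (d : Fin 2 →₀ ℕ) (hd : d ∈ P.support) :
    (MvPolynomial.aeval ![lvar k a, lvar k b] P).coeff (d 0 • expo a + d 1 • expo b) =
      P.coeff d := by
  rw [aeval_lvar_coeff, Finset.sum_eq_single_of_mem d hd, if_pos rfl]
  refine fun d' _ hne => if_neg fun h => hne ?_
  ext i
  have ha := congrFun h a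
  have hb := congrFun h b
  simp [hab, hab.symm] at ha hb
  fin_cases i
  · exact ha
  · exact hb

theorem aeval_lvar_coeff_eq_zero {k : Type} [Field k] {a b i : Fin 4} (hia : i ≠ a)
    (hib : i ≠ b) (P : MvPolynomial (Fin 2) k) (m : Fin 4 → ℤ) (hm : m i ≠ 0) :
    (MvPolynomial.aeval ![lvar k a, lvar k b] P).coeff m = 0 := by
  rw [aeval_lvar_coeff]
  refine Finset.sum_eq_zero fun d _ => if_neg fun h => hm ?_
  rw [← h]
  simp [hia, hib]

theorem map_aeval_pair {k A B : Type} [Field k] [CommRing A] [Algebra k A] [CommRing B]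
    [Algebra k B] (Φ : A →ₐ[k] B) (f g : A) (P : MvPolynomial (Fin 2) k) :
    Φ (MvPolynomial.aeval ![f, g] P) = MvPolynomial.aeval ![Φ f, Φ g] P := by
  rw [MvPolynomial.comp_aeval_apply]
  congr 2
  ext i
  fin_cases i <;> rfl

theorem nuSup_add_mul_le {k : Type} [Field k] (p : Fin 4 → k) (α : Fin 4 → ℝ)
    (hα : ∀ i, α i < 0) (h : α 0 + α 3 = α 1 + α 2) {a c : Fin 4}
    (ha0 : a ≠ 0) (hac : a ≠ c) (hc0 : c ≠ 0) (hc3 : c ≠ 3) (P : MvPolynomial (Fin 2) k) :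
    nuSup k p α (qmk k (X 0) + qmk k (X a) *
      MvPolynomial.aeval ![qmk k (X a), qmk k (X 3)] P) ≤ (α 0 : ℝ) := by
  obtain ⟨Φ, hΦ, hle⟩ := exists_laurent_hom k c hc3
  refine (hle p α hα h _ (expo 0) ?_).trans_eq (by simp [laurentWeight_single])
  rw [map_add, map_mul, map_aeval_pair, hΦ 0 hc0.symm, hΦ a hac, hΦ 3 hc3.symm]
  simp [aeval_lvar_coeff_eq_zero (k := k) (b := 3) ha0.symm (by decide) P (-expo a + expo 0)
    (by simp [ha0.symm])]

theorem nuSup_add_mul_lt {k : Type} [Field k] (p : Fin 4 → k) (α : Fin 4 → ℝ)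
    (hα : ∀ i, α i < 0) (h : α 0 + α 3 = α 1 + α 2) {a c : Fin 4}
    (ha0 : a ≠ 0) (ha3 : a ≠ 3) (hac : a ≠ c) (hc0 : c ≠ 0) (hc3 : c ≠ 3)
    (hlt : 2 * α 3 < α a) (P : MvPolynomial (Fin 2) k) (hP : ¬ ∃ c : k, P = C c) :
    nuSup k p α (qmk k (X c) + qmk k (X 3) *
      MvPolynomial.aeval ![qmk k (X a), qmk k (X 3)] P) < (α a : ℝ) := by
  classical
  obtain ⟨d, hd, hd0⟩ : ∃ d ∈ P.support, d ≠ 0 := by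
    by_contra! hall
    refine hP ⟨P.coeff 0, ?_⟩
    ext d
    rw [MvPolynomial.coeff_C]
    split_ifs with hd
    · rw [← hd]
    · by_contra hne
      exact hd (hall d (MvPolynomial.mem_support_iff.2 hne)).symm
  obtain ⟨Φ, hΦ, hle⟩ := exists_laurent_hom k 0 (by decide)
  refine (hle p α hα h _ (expo 3 + (d 0 • expo a + d 1 • expo 3)) ?_).trans_lt
    (WithTop.coe_lt_coe.2 ?_)
  · rw [map_add Φ, map_mul Φ, map_aeval_pair, hΦ c hc0, hΦ a ha0, hΦ 3 (by decide)]
    have hne : expo c ≠ expo 3 + (d 0 • expo a + d 1 • expo 3) := by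
      intro he
      have := congrFun he c
      simp [hc3, hac.symm] at this
    have := aeval_lvar_coeff_of_mem ha3 P d hd
    rw [AddMonoidAlgebra.coeff_add, Finsupp.add_apply, AddMonoidAlgebra.coeff_single,
      Finsupp.single_eq_of_ne hne.symm, AddMonoidAlgebra.coeff_single_mul_apply,
      neg_add_cancel_left, this]
    simpa using hd
  · simp only [map_add, map_nsmul, laurentWeight_single]
    have h1 := hα 3
    have h2 := hα a
    have hd1 : 1 ≤ d 0 ∨ 1 ≤ d 1 := by
      by_contra! hlt
      refine hd0 ?_
      ext i
      fin_cases i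
      · simpa using hlt.1
      · simpa using hlt.2
    have e0 : (0 : ℝ) ≤ d 0 := Nat.cast_nonneg _
    have e1 : (0 : ℝ) ≤ d 1 := Nat.cast_nonneg _
    simp only [nsmul_eq_mul, Int.cast_one, mul_one]
    rcases hd1 with hd1 | hd1
    · have : (1 : ℝ) ≤ d 0 := by exact_mod_cast hd1
      nlinarith
    · have : (1 : ℝ) ≤ d 1 := by exact_mod_cast hd1
      nlinarith

/-- cf. Lemma 5.17: let `ν ∈ 𝒱₀` satisfy
`max(ν(y) + ν(t), ν(z) + ν(t)) < ν(x) < min(ν(y), ν(z), ν(t))`. Then for every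
nonconstant polynomial `P ∈ k[X,Y]`:
(a) `ν(y) < ν(t)`, `ν(x + y·P(y,t)) < ν(t)` and `ν(z + t·P(y,t)) < ν(y)`; and
(b) `ν(z) < ν(t)`, `ν(x + z·P(z,t)) < ν(t)` and `ν(y + t·P(z,t)) < ν(z)`. -/
theorem val_standard_square_estimates (k : Type) [Field k] [IsAlgClosed k] [CharZero k]
    (ν : QuadRing k → WithTop ℝ) (hν : ν ∈ V0 k)
    (hlow : max (ν (qmk k (X 1)) + ν (qmk k (X 3))) (ν (qmk k (X 2)) + ν (qmk k (X 3)))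
        < ν (qmk k (X 0)))
    (hhigh : ν (qmk k (X 0))
        < min (ν (qmk k (X 1))) (min (ν (qmk k (X 2))) (ν (qmk k (X 3))))) :
    ∀ P : MvPolynomial (Fin 2) k, (¬ ∃ c : k, P = C c) →
      (ν (qmk k (X 1)) < ν (qmk k (X 3)) ∧
        ν (qmk k (X 0) + qmk k (X 1) *
            MvPolynomial.aeval ![qmk k (X 1), qmk k (X 3)] P) < ν (qmk k (X 3)) ∧
        ν (qmk k (X 2) + qmk k (X 3) *
            MvPolynomial.aeval ![qmk k (X 1), qmk k (X 3)] P) < ν (qmk k (X 1))) ∧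
      (ν (qmk k (X 2)) < ν (qmk k (X 3)) ∧
        ν (qmk k (X 0) + qmk k (X 2) *
            MvPolynomial.aeval ![qmk k (X 2), qmk k (X 3)] P) < ν (qmk k (X 3)) ∧
        ν (qmk k (X 1) + qmk k (X 3) *
            MvPolynomial.aeval ![qmk k (X 2), qmk k (X 3)] P) < ν (qmk k (X 2))) := by
  obtain ⟨p, α, hα, h, rfl⟩ := hν
  simp only [nuSup_X k p α hα h, ← WithTop.coe_add, max_lt_iff, lt_min_iff,
    WithTop.coe_lt_coe] at hlow hhigh ⊢
  obtain ⟨h13, h23⟩ := hlow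
  obtain ⟨h01, h02, h03⟩ := hhigh
  intro P hP
  refine ⟨⟨by linarith, ?_, ?_⟩, by linarith, ?_, ?_⟩
  · exact (nuSup_add_mul_le p α hα h (c := 2) (by decide) (by decide) (by decide) (by decide)
      P).trans_lt (WithTop.coe_lt_coe.2 h03)
  · exact nuSup_add_mul_lt p α hα h (by decide) (by decide) (by decide) (by decide) (by decide)
      (by linarith) P hP
  · exact (nuSup_add_mul_le p α hα h (c := 1) (by decide) (by decide) (by decide) (by decide)
      P).trans_lt (WithTop.coe_lt_coe.2 h03)
  · exact nuSup_add_mul_lt p α hα h (by decide) (by decide) (by decide) (by decide) (by decide)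
      (by linarith) P hP
end
end
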